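/- Let Λ be a finite dimensional 1-Iwanaga-Gorenstein algebra over a field K, i.e., the injective dimensions of Λ as a right module and as a left module are both at most 1. Then the following are equivalent: (1) Λ is self-injective; (2) all functorially finite torsion pairs in mod Λ are Gorenstein; (3) all support τ-tilting Λ-modules are Gorenstein projective; (4) all support τ⁻¹-tilting Λ-modules are Gorenstein injective; (5) all τ-rigid Λ-modules are Gorenstein projective; (6) all τ⁻¹-rigid Λ-modules are Gorenstein injective. -/

import Mathlib

/-!  Common definitions: Gorenstein projective/injective modules, transpose,
Auslander–Reiten translation, τ-rigid and τ-tilting modules and pairs,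
torsion pairs, etc., over a finite dimensional algebra.
Throughout, "mod Λ" is modelled by the category of finitely generated
(left) modules over a finite dimensional `K`-algebra `R`, and
"mod Λᵒᵖ" by finitely generated `Rᵐᵒᵖ`-modules. -/

universe u

open Function MulOpposite

namespace GPTau

section Ring

variable (R : Type u) [Ring R]

/-- A submodule `N ≤ M` is superfluous (small) if `N ⊔ N' = ⊤` implies `N' = ⊤`. -/
def IsSuperfluous {M : Type u} [AddCommGroup M] [Module R M] (N : Submodule R M) : Prop :=
  ∀ N' : Submodule R M, N ⊔ N' = ⊤ → N' = ⊤

/-- `M` is Gorenstein projective: there is a doubly infinite exact sequence of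
finitely generated projective modules which stays exact under `Hom(-, R)` and
such that `M ≅ Im (P₋₁ → P₀)`. -/
def IsGP (M : Type u) [AddCommGroup M] [Module R M] : Prop :=
  ∃ (P : ℤ → Type u) (_ : ∀ n, AddCommGroup (P n)) (_ : ∀ n, Module R (P n))
    (d : ∀ n : ℤ, P n →ₗ[R] P (n + 1)),
    (∀ n, Module.Finite R (P n)) ∧
    (∀ n, Module.Projective R (P n)) ∧
    (∀ n, Function.Exact (d n) (d (n + 1))) ∧
    (∀ n, Function.Exact
      (fun g : P (n + 1 + 1) →ₗ[R] R => g.comp (d (n + 1)))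
      (fun g : P (n + 1) →ₗ[R] R => g.comp (d n))) ∧
    Nonempty (M ≃ₗ[R] LinearMap.range (d (-1)))

/-- A linear map factors through a (finitely generated) projective module. -/
def FactorsThroughProj {A B : Type u} [AddCommGroup A] [Module R A]
    [AddCommGroup B] [Module R B] (f : A →ₗ[R] B) : Prop :=
  ∃ (Q : Type u) (_ : AddCommGroup Q) (_ : Module R Q),
    Module.Projective R Q ∧ ∃ (a : A →ₗ[R] Q) (b : Q →ₗ[R] B), b.comp a = f

/-- Two maps are equal in the stable category (mod projectives). -/
def StEq {A B : Type u} [AddCommGroup A] [Module R A] [AddCommGroup B] [Module R B]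
    (f g : A →ₗ[R] B) : Prop :=
  FactorsThroughProj R (f - g)

/-- An indecomposable module. -/
def IsIndec (M : Type u) [AddCommGroup M] [Module R M] : Prop :=
  Nontrivial M ∧ ∀ N₁ N₂ : Submodule R M, IsCompl N₁ N₂ → N₁ = ⊥ ∨ N₂ = ⊥

/-- `|M| = k` : `M` decomposes into indecomposable direct summands having
exactly `k` isomorphism classes. -/
def NumIndec (M : Type u) [AddCommGroup M] [Module R M] (k : ℕ) : Prop :=
  ∃ (n : ℕ) (N : Fin n → Submodule R M),
    DirectSum.IsInternal N ∧ (∀ i, IsIndec R (N i)) ∧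
    ∃ c : Fin n → Fin k, Surjective c ∧
      ∀ i j, (c i = c j ↔ Nonempty ((N i) ≃ₗ[R] (N j)))

/-- A basic module: it is a direct sum of pairwise nonisomorphic indecomposables. -/
def IsBasic (M : Type u) [AddCommGroup M] [Module R M] : Prop :=
  ∃ (n : ℕ) (N : Fin n → Submodule R M),
    DirectSum.IsInternal N ∧ (∀ i, IsIndec R (N i)) ∧
    ∀ i j, i ≠ j → ¬ Nonempty ((N i) ≃ₗ[R] (N j))

/-- `M` has no nonzero projective direct summand. -/
def NoProjSummand (M : Type u) [AddCommGroup M] [Module R M] : Prop :=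
  ∀ N₁ N₂ : Submodule R M, IsCompl N₁ N₂ → Module.Projective R N₁ → N₁ = ⊥

/-- `X` is a direct summand of `T`. -/
def IsDirectSummand (X T : Type u) [AddCommGroup X] [Module R X]
    [AddCommGroup T] [Module R T] : Prop :=
  ∃ (i : X →ₗ[R] T) (p : T →ₗ[R] X), p.comp i = LinearMap.id

/-- `Ext¹(X, Y) = 0`: every short exact sequence `0 → Y → E → X → 0` splits. -/
def Ext1Vanishes (X Y : Type u) [AddCommGroup X] [Module R X]
    [AddCommGroup Y] [Module R Y] : Prop :=
  ∀ (E : Type u) [AddCommGroup E] [Module R E] (i : Y →ₗ[R] E) (p : E →ₗ[R] X),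
    Injective i → Surjective p → Function.Exact i p →
    ∃ s : X →ₗ[R] E, p.comp s = LinearMap.id

/-- `X ∈ Fac G`: `X` is a quotient of a finite direct sum of copies of `G`. -/
def FacOf (G X : Type u) [AddCommGroup G] [Module R G] [AddCommGroup X] [Module R X] : Prop :=
  ∃ (n : ℕ) (p : (Fin n → G) →ₗ[R] X), Surjective p

/-- `X ∈ Sub C`: `X` embeds into a finite direct sum of copies of `C`. -/
def SubOf (C X : Type u) [AddCommGroup C] [Module R C] [AddCommGroup X] [Module R X] : Prop :=
  ∃ (n : ℕ) (i : X →ₗ[R] (Fin n → C)), Injective i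

/-- `X ∈ add G`: `X` is a direct summand of a finite direct sum of copies of `G`. -/
def InAdd (G X : Type u) [AddCommGroup G] [Module R G] [AddCommGroup X] [Module R X] : Prop :=
  ∃ (n : ℕ) (i : X →ₗ[R] (Fin n → G)) (p : (Fin n → G) →ₗ[R] X), p.comp i = LinearMap.id

/-- The Jacobson radical of `R` (as a left ideal). -/
def JacobsonRad : Ideal R := (⊥ : Ideal R).jacobson

/-- The Jacobson radical squares to zero. -/
def RadSquareZero : Prop :=
  ∀ x y : R, x ∈ JacobsonRad R → y ∈ JacobsonRad R → x * y = 0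

/-- A uniserial module: its submodules form a chain. -/
def IsUniserial (M : Type u) [AddCommGroup M] [Module R M] : Prop :=
  ∀ N₁ N₂ : Submodule R M, N₁ ≤ N₂ ∨ N₂ ≤ N₁

/-- `R` has finite global dimension: there is `n` such that every finitely
generated module has a projective resolution vanishing in degrees `> n`. -/
def FiniteGlobalDimension : Prop :=
  ∃ n : ℕ, ∀ (M : Type u) [AddCommGroup M] [Module R M], Module.Finite R M →
    ∃ (P : ℕ → Type u) (_ : ∀ i, AddCommGroup (P i)) (_ : ∀ i, Module R (P i))
      (d : ∀ i : ℕ, P (i + 1) →ₗ[R] P i) (ε : P 0 →ₗ[R] M),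
      (∀ i, Module.Projective R (P i)) ∧ Surjective ε ∧
      Function.Exact (d 0) ε ∧ (∀ i, Function.Exact (d (i + 1)) (d i)) ∧
      (∀ i, n < i → Subsingleton (P i))

/-- The injective dimension of `R` as a module over itself is at most 1. -/
def SelfInjDimLE1 : Prop :=
  ∃ (I₀ I₁ : Type u) (_ : AddCommGroup I₀) (_ : Module R I₀)
    (_ : AddCommGroup I₁) (_ : Module R I₁),
    Module.Finite R I₀ ∧ Module.Finite R I₁ ∧
    Module.Injective R I₀ ∧ Module.Injective R I₁ ∧
    ∃ (i : R →ₗ[R] I₀) (p : I₀ →ₗ[R] I₁),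
      Injective i ∧ Surjective p ∧ Function.Exact i p

end Ring

section Algebra

variable (R : Type u) [Ring R] (K : Type u) [Field K] [Algebra K R]

/-- For an algebra over a field, the scalars of the base field commute with the
ring action on any compatible module. -/
instance (priority := 100) smulCommClass_of_tower (M : Type u) [AddCommGroup M]
    [Module R M] [Module K M] [IsScalarTower K R M] : SMulCommClass R K M :=
  ⟨fun r k m => by
    rw [← algebraMap_smul R k m, ← mul_smul, ← Algebra.commutes, mul_smul, algebraMap_smul]⟩

end Algebra

section OpDual

variable (R : Type u) [Ring R] (K : Type u) [Field K] [Algebra K R]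
variable (M : Type u) [AddCommGroup M] [Module Rᵐᵒᵖ M] [Module K M]
  [IsScalarTower K Rᵐᵒᵖ M]

/-- The `K`-dual of a (finitely generated) `Rᵐᵒᵖ`-module, as an `R`-module:
this is the duality `D : mod Λᵒᵖ → mod Λ`. -/
def OpDual (R : Type u) [Ring R] (K : Type u) [Field K] [Algebra K R]
    (M : Type u) [AddCommGroup M] [Module Rᵐᵒᵖ M] [Module K M]
    [IsScalarTower K Rᵐᵒᵖ M] : Type u := M →ₗ[K] K

instance : AddCommGroup (OpDual R K M) := inferInstanceAs (AddCommGroup (M →ₗ[K] K))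

instance : Module K (OpDual R K M) := inferInstanceAs (Module K (M →ₗ[K] K))

/-- Scalar action `x ↦ op r • x` as a `K`-linear map. -/
def opSmulHom (r : R) : M →ₗ[K] M where
  toFun x := op r • x
  map_add' x y := smul_add _ x y
  map_smul' k x := smul_comm (op r) k x

/-- Reinterpret an element of the dual as a linear functional. -/
def OpDual.toL (f : OpDual R K M) : M →ₗ[K] K := f

lemma OpDual.toL_injective :
    Function.Injective (OpDual.toL R K M) := fun _ _ h => h

instance : SMul R (OpDual R K M) :=
  ⟨fun r f => ((OpDual.toL R K M f).comp (opSmulHom R K M r) : M →ₗ[K] K)⟩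

lemma OpDual.smul_toL (r : R) (f : OpDual R K M) (x : M) :
    OpDual.toL R K M (r • f) x = OpDual.toL R K M f (op r • x) := rfl

lemma OpDual.toL_add (f g : OpDual R K M) :
    OpDual.toL R K M (f + g) = OpDual.toL R K M f + OpDual.toL R K M g := rfl

lemma OpDual.toL_zero : OpDual.toL R K M 0 = 0 := rfl

instance : Module R (OpDual R K M) where
  one_smul f := OpDual.toL_injective R K M <| LinearMap.ext fun x => by
    rw [OpDual.smul_toL, op_one, one_smul]
  mul_smul r s f := OpDual.toL_injective R K M <| LinearMap.ext fun x => by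
    rw [OpDual.smul_toL, OpDual.smul_toL, OpDual.smul_toL, op_mul, mul_smul]
  smul_zero r := OpDual.toL_injective R K M <| LinearMap.ext fun x => by
    rw [OpDual.smul_toL, OpDual.toL_zero]; simp
  smul_add r f g := OpDual.toL_injective R K M <| LinearMap.ext fun x => by
    rw [OpDual.smul_toL, OpDual.toL_add]
    simp only [LinearMap.add_apply, OpDual.toL_add]
    rw [OpDual.smul_toL, OpDual.smul_toL]
  add_smul r s f := OpDual.toL_injective R K M <| LinearMap.ext fun x => by
    rw [OpDual.smul_toL]
    simp only [OpDual.toL_add, LinearMap.add_apply]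
    rw [OpDual.smul_toL, OpDual.smul_toL, op_add, add_smul, map_add]
  zero_smul f := OpDual.toL_injective R K M <| LinearMap.ext fun x => by
    rw [OpDual.smul_toL, OpDual.toL_zero, op_zero, zero_smul, map_zero]; rfl

instance : IsScalarTower K R (OpDual R K M) :=
  ⟨fun k r f => OpDual.toL_injective R K M <| LinearMap.ext fun x => by
    have h1 : OpDual.toL R K M ((k • r) • f) x = OpDual.toL R K M f (op (k • r) • x) := rfl
    have h2 : OpDual.toL R K M (k • (r • f)) x = k • OpDual.toL R K M f (op r • x) := rfl
    rw [h1, h2, op_smul, smul_assoc, map_smul]⟩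

end OpDual

section LDual

variable (R : Type u) [Ring R] (K : Type u) [Field K] [Algebra K R]
variable (M : Type u) [AddCommGroup M] [Module R M] [Module K M]
  [IsScalarTower K R M]

/-- The `K`-dual of a (finitely generated) `R`-module, as an `Rᵐᵒᵖ`-module:
this is the duality `D : mod Λ → mod Λᵒᵖ`. -/
def LDual (R : Type u) [Ring R] (K : Type u) [Field K] [Algebra K R]
    (M : Type u) [AddCommGroup M] [Module R M] [Module K M]
    [IsScalarTower K R M] : Type u := M →ₗ[K] K

instance : AddCommGroup (LDual R K M) := inferInstanceAs (AddCommGroup (M →ₗ[K] K))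

instance : Module K (LDual R K M) := inferInstanceAs (Module K (M →ₗ[K] K))

/-- Scalar action `x ↦ r • x` as a `K`-linear map. -/
def lSmulHom (r : R) : M →ₗ[K] M where
  toFun x := r • x
  map_add' x y := smul_add _ x y
  map_smul' k x := smul_comm r k x

/-- Reinterpret an element of the dual as a linear functional. -/
def LDual.toL (f : LDual R K M) : M →ₗ[K] K := f

lemma LDual.toL_injective : Function.Injective (LDual.toL R K M) := fun _ _ h => h

instance : SMul Rᵐᵒᵖ (LDual R K M) :=
  ⟨fun s f => ((LDual.toL R K M f).comp (lSmulHom R K M (unop s)) : M →ₗ[K] K)⟩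

lemma LDual.smul_toL (s : Rᵐᵒᵖ) (f : LDual R K M) (x : M) :
    LDual.toL R K M (s • f) x = LDual.toL R K M f (unop s • x) := rfl

lemma LDual.toL_add (f g : LDual R K M) :
    LDual.toL R K M (f + g) = LDual.toL R K M f + LDual.toL R K M g := rfl

lemma LDual.toL_zero : LDual.toL R K M 0 = 0 := rfl

instance : Module Rᵐᵒᵖ (LDual R K M) where
  one_smul f := LDual.toL_injective R K M <| LinearMap.ext fun x => by
    rw [LDual.smul_toL, unop_one, one_smul]
  mul_smul s t f := LDual.toL_injective R K M <| LinearMap.ext fun x => by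
    rw [LDual.smul_toL, LDual.smul_toL, LDual.smul_toL, unop_mul, mul_smul]
  smul_zero s := LDual.toL_injective R K M <| LinearMap.ext fun x => by
    rw [LDual.smul_toL, LDual.toL_zero]; simp
  smul_add s f g := LDual.toL_injective R K M <| LinearMap.ext fun x => by
    rw [LDual.smul_toL, LDual.toL_add]
    simp only [LinearMap.add_apply, LDual.toL_add]
    rw [LDual.smul_toL, LDual.smul_toL]
  add_smul s t f := LDual.toL_injective R K M <| LinearMap.ext fun x => by
    rw [LDual.smul_toL]
    simp only [LDual.toL_add, LinearMap.add_apply]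
    rw [LDual.smul_toL, LDual.smul_toL, unop_add, add_smul, map_add]
  zero_smul f := LDual.toL_injective R K M <| LinearMap.ext fun x => by
    rw [LDual.smul_toL, LDual.toL_zero, unop_zero, zero_smul, map_zero]; rfl

instance : IsScalarTower K Rᵐᵒᵖ (LDual R K M) :=
  ⟨fun k s f => LDual.toL_injective R K M <| LinearMap.ext fun x => by
    have h1 : LDual.toL R K M ((k • s) • f) x = LDual.toL R K M f (unop (k • s) • x) := rfl
    have h2 : LDual.toL R K M (k • (s • f)) x = k • LDual.toL R K M f (unop s • x) := rfl
    rw [h1, h2, unop_smul, smul_assoc, map_smul]⟩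

end LDual

section GI

variable (R : Type u) [Ring R] (K : Type u) [Field K] [Algebra K R]

/-- `M` is Gorenstein injective: there is a doubly infinite exact sequence of
finitely generated injective modules which stays exact under `Hom(DΛ, -)` and
such that `M ≅ Im (I₋₁ → I₀)`. Here `DΛ = OpDual R K R` is the `K`-dual of the
regular module. -/
def IsGI (M : Type u) [AddCommGroup M] [Module R M] : Prop :=
  ∃ (I : ℤ → Type u) (_ : ∀ n, AddCommGroup (I n)) (_ : ∀ n, Module R (I n))
    (d : ∀ n : ℤ, I n →ₗ[R] I (n + 1)),
    (∀ n, Module.Finite R (I n)) ∧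
    (∀ n, Module.Injective R (I n)) ∧
    (∀ n, Function.Exact (d n) (d (n + 1))) ∧
    (∀ n, Function.Exact
      (fun g : OpDual R K R →ₗ[R] I n => (d n).comp g)
      (fun g : OpDual R K R →ₗ[R] I (n + 1) => (d (n + 1)).comp g)) ∧
    Nonempty (M ≃ₗ[R] LinearMap.range (d (-1)))

end GI



section MinPres

variable (R : Type u) [Ring R]

/-- A minimal projective presentation `P₁ → P₀ → M → 0`. -/
structure MinPres (M : Type u) [AddCommGroup M] [Module R M] : Type (u + 1) where
  P₁ : Type u
  P₀ : Type u
  [acg₁ : AddCommGroup P₁]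
  [acg₀ : AddCommGroup P₀]
  [mod₁ : Module R P₁]
  [mod₀ : Module R P₀]
  fin₁ : Module.Finite R P₁
  fin₀ : Module.Finite R P₀
  proj₁ : Module.Projective R P₁
  proj₀ : Module.Projective R P₀
  d : P₁ →ₗ[R] P₀
  p : P₀ →ₗ[R] M
  surj : Function.Surjective p
  exact : Function.Exact d p
  min₀ : IsSuperfluous R (LinearMap.ker p)
  min₁ : IsSuperfluous R (LinearMap.ker d)

attribute [instance] MinPres.acg₁ MinPres.acg₀ MinPres.mod₁ MinPres.mod₀

variable {R}
variable {M : Type u} [AddCommGroup M] [Module R M] (pr : MinPres R M)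

/-- The map `Hom(P₀, R) → Hom(P₁, R)` dual to `d`, as a map of `Rᵐᵒᵖ`-modules. -/
def MinPres.dualMap : (pr.P₀ →ₗ[R] R) →ₗ[Rᵐᵒᵖ] (pr.P₁ →ₗ[R] R) where
  toFun g := g.comp pr.d
  map_add' g h := by ext x; simp
  map_smul' s g := by ext x; simp

/-- The transpose `Tr M = Coker (Hom(P₀, R) → Hom(P₁, R))`, an `Rᵐᵒᵖ`-module. -/
def MinPres.Tr : Type u := (pr.P₁ →ₗ[R] R) ⧸ LinearMap.range pr.dualMap

instance : AddCommGroup pr.Tr :=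
  inferInstanceAs (AddCommGroup ((pr.P₁ →ₗ[R] R) ⧸ LinearMap.range pr.dualMap))

instance : Module Rᵐᵒᵖ pr.Tr :=
  inferInstanceAs (Module Rᵐᵒᵖ ((pr.P₁ →ₗ[R] R) ⧸ LinearMap.range pr.dualMap))

/-- The canonical projection onto the transpose. -/
def MinPres.toTr (h : pr.P₁ →ₗ[R] R) : pr.Tr :=
  Submodule.Quotient.mk (p := LinearMap.range pr.dualMap) h

section TauDef

variable (K : Type u) [Field K] [Algebra K R]

instance : Module K pr.Tr :=
  inferInstanceAs (Module K ((pr.P₁ →ₗ[R] R) ⧸ LinearMap.range pr.dualMap))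

instance : IsScalarTower K Rᵐᵒᵖ pr.Tr :=
  inferInstanceAs
    (IsScalarTower K Rᵐᵒᵖ ((pr.P₁ →ₗ[R] R) ⧸ LinearMap.range pr.dualMap))

/-- The Auslander–Reiten translate `τM = D (Tr M)`, an `R`-module. -/
def MinPres.tau : Type u := OpDual R K pr.Tr

instance : AddCommGroup (pr.tau K) := inferInstanceAs (AddCommGroup (OpDual R K pr.Tr))

instance : Module R (pr.tau K) := inferInstanceAs (Module R (OpDual R K pr.Tr))

instance : Module K (pr.tau K) := inferInstanceAs (Module K (OpDual R K pr.Tr))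

instance : IsScalarTower K R (pr.tau K) :=
  inferInstanceAs (IsScalarTower K R (OpDual R K pr.Tr))

end TauDef

end MinPres

section Tau

variable (R : Type u) [Ring R] (K : Type u) [Field K] [Algebra K R]

/-- `M` is τ-rigid: `Hom(M, τM) = 0`. -/
def IsTauRigid (M : Type u) [AddCommGroup M] [Module R M] : Prop :=
  ∀ pr : MinPres R M, ∀ f : M →ₗ[R] pr.tau K, f = 0

/-- `N ∈ ⊥(τM)`, i.e. `Hom(N, τM) = 0`. -/
def InPerpTau (M : Type u) [AddCommGroup M] [Module R M]
    (N : Type u) [AddCommGroup N] [Module R N] : Prop :=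
  ∀ pr : MinPres R M, ∀ f : N →ₗ[R] pr.tau K, f = 0

/-- `M` is a τ-tilting module: τ-rigid with `|M| = |R|`. -/
def IsTauTilting (M : Type u) [AddCommGroup M] [Module R M] : Prop :=
  IsTauRigid R K M ∧ ∃ m l : ℕ, NumIndec R M m ∧ NumIndec R R l ∧ m = l

/-- `M` is τ⁻¹-rigid: `Hom(τ⁻¹M, M) = 0`, where `τ⁻¹M = Tr (D M)`.
A homomorphism `τ⁻¹M → M` is an additive map compatible with the identification
`R ≅ Rᵐᵒᵖᵐᵒᵖ` of scalars. -/
def IsTauInvRigid (M : Type u) [AddCommGroup M] [Module R M] [Module K M]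
    [IsScalarTower K R M] : Prop :=
  ∀ pr : MinPres Rᵐᵒᵖ (LDual R K M), ∀ f : pr.Tr →+ M,
    (∀ (r : R) (x : pr.Tr), f (op (op r) • x) = r • f x) → f = 0

/-- `M` is a τ⁻¹-tilting module. -/
def IsTauInvTilting (M : Type u) [AddCommGroup M] [Module R M] [Module K M]
    [IsScalarTower K R M] : Prop :=
  IsTauInvRigid R K M ∧ ∃ m l : ℕ, NumIndec R M m ∧ NumIndec R R l ∧ m = l

end Tau

section Pairs

variable (K : Type u) [Field K] (R : Type u) [Ring R] [Algebra K R]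

/-- A pair `(M, P)` of finitely generated modules (with compatible `K`-structure). -/
structure ModPair : Type (u + 1) where
  M : Type u
  [acgM : AddCommGroup M]
  [modM : Module R M]
  [modKM : Module K M]
  [towM : IsScalarTower K R M]
  finM : Module.Finite R M
  P : Type u
  [acgP : AddCommGroup P]
  [modP : Module R P]
  [modKP : Module K P]
  [towP : IsScalarTower K R P]
  finP : Module.Finite R P

attribute [instance] ModPair.acgM ModPair.modM ModPair.modKM ModPair.towM
attribute [instance] ModPair.acgP ModPair.modP ModPair.modKP ModPair.towP

variable {K R}

/-- Isomorphism of pairs. -/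
def ModPair.Iso (x y : ModPair K R) : Prop :=
  Nonempty (x.M ≃ₗ[R] y.M) ∧ Nonempty (x.P ≃ₗ[R] y.P)

variable (K R)

/-- The setoid of pairs satisfying a property `Q`, up to isomorphism. -/
def pairSetoid (Q : ModPair K R → Prop) : Setoid {x : ModPair K R // Q x} where
  r a b := ModPair.Iso a.1 b.1
  iseqv := by
    constructor
    · exact fun a => ⟨⟨LinearEquiv.refl R a.1.M⟩, ⟨LinearEquiv.refl R a.1.P⟩⟩
    · rintro a b ⟨⟨e⟩, ⟨e'⟩⟩; exact ⟨⟨e.symm⟩, ⟨e'.symm⟩⟩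
    · rintro a b c ⟨⟨e⟩, ⟨e'⟩⟩ ⟨⟨f⟩, ⟨f'⟩⟩; exact ⟨⟨e.trans f⟩, ⟨e'.trans f'⟩⟩

/-- `(M, P)` is a τ-rigid pair: `M` is τ-rigid, `P` is projective and `Hom(P, M) = 0`. -/
def IsTauRigidPair (x : ModPair K R) : Prop :=
  IsTauRigid R K x.M ∧ Module.Projective R x.P ∧ ∀ f : x.P →ₗ[R] x.M, f = 0

/-- A Gorenstein projective τ-rigid pair. -/
def IsGPTauRigidPair (x : ModPair K R) : Prop :=
  IsTauRigidPair K R x ∧ IsGP R x.M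

/-- A support τ-tilting pair: a τ-rigid pair with `|M| + |P| = |R|`. -/
def IsSuppTauTiltingPair (x : ModPair K R) : Prop :=
  IsTauRigidPair K R x ∧
    ∃ m p l : ℕ, NumIndec R x.M m ∧ NumIndec R x.P p ∧ NumIndec R R l ∧ m + p = l

/-- A Gorenstein projective support τ-tilting pair. -/
def IsGPSuppTauTiltingPair (x : ModPair K R) : Prop :=
  IsSuppTauTiltingPair K R x ∧ IsGP R x.M

/-- `(I, N)` is a τ⁻¹-rigid pair; here `x.M = N` is the module and `x.P = I` is
injective, with `Hom(N, I) = 0`. -/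
def IsTauInvRigidPair (x : ModPair K R) : Prop :=
  IsTauInvRigid R K x.M ∧ Module.Injective R x.P ∧ ∀ f : x.M →ₗ[R] x.P, f = 0

/-- A Gorenstein injective τ⁻¹-rigid pair. -/
def IsGITauInvRigidPair (x : ModPair K R) : Prop :=
  IsTauInvRigidPair K R x ∧ IsGI R K x.M

/-- A support τ⁻¹-tilting pair: a τ⁻¹-rigid pair with `|N| + |I| = |R|`. -/
def IsSuppTauInvTiltingPair (x : ModPair K R) : Prop :=
  IsTauInvRigidPair K R x ∧
    ∃ m p l : ℕ, NumIndec R x.M m ∧ NumIndec R x.P p ∧ NumIndec R R l ∧ m + p = l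

/-- A Gorenstein injective support τ⁻¹-tilting pair. -/
def IsGISuppTauInvTiltingPair (x : ModPair K R) : Prop :=
  IsSuppTauInvTiltingPair K R x ∧ IsGI R K x.M

/-- A basic pair. -/
def IsBasicPair (x : ModPair K R) : Prop := IsBasic R x.M ∧ IsBasic R x.P

/-- `y` is (a representative of) the dagger `(M, P)† = (Tr M_np ⊕ P*, M_p*)` of `x`,
where `M = M_p ⊕ M_np` with `M_p` a maximal projective direct summand. -/
def IsDaggerOf (x : ModPair K R) (y : ModPair K Rᵐᵒᵖ) : Prop :=
  ∃ Mp Mnp : Submodule R x.M, IsCompl Mp Mnp ∧ Module.Projective R Mp ∧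
    NoProjSummand R Mnp ∧
    ∃ pr : MinPres R Mnp,
      Nonempty (y.M ≃ₗ[Rᵐᵒᵖ] (pr.Tr × (x.P →ₗ[R] R))) ∧
      Nonempty (y.P ≃ₗ[Rᵐᵒᵖ] (Mp →ₗ[R] R))

/-- `y` is (a representative of) `D((M, P)†)`, the Gorenstein injective pair
`(D(M_p*), D(Tr M_np ⊕ P*))` associated to `x`; in our convention `y.M` is the
τ⁻¹-rigid module `D(Tr M_np ⊕ P*)` and `y.P` is the injective module `D(M_p*)`. -/
def IsDDaggerOf (x : ModPair K R) (y : ModPair K R) : Prop :=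
  ∃ z : ModPair K Rᵐᵒᵖ, IsDaggerOf K R x z ∧
    Nonempty (y.M ≃ₗ[R] OpDual R K z.M) ∧ Nonempty (y.P ≃ₗ[R] OpDual R K z.P)

end Pairs

section Support

variable (R : Type u) [Ring R] (K : Type u) [Field K] [Algebra K R]

/-- `φ : R →+* S` realizes `S` as the quotient of `R` by the two-sided ideal
generated by `e` (universal property). -/
def IsQuotientByIdem (e : R) (S : Type u) [Ring S] (φ : R →+* S) : Prop :=
  Function.Surjective φ ∧ φ e = 0 ∧
    ∀ (S' : Type u) (_ : Ring S') (ψ : R →+* S'), ψ e = 0 → ∃ χ : S →+* S', χ.comp φ = ψ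

/-- `M` is a support τ-tilting module: `M` is a τ-tilting module over `Λ/(e)` for
some idempotent `e`. -/
def IsSuppTauTilting (M : Type u) [AddCommGroup M] [Module R M] : Prop :=
  ∃ e : R, IsIdempotentElem e ∧
    ∃ (S : Type u) (_ : Ring S) (_ : Algebra K S) (φ : R →+* S),
      (∀ k : K, φ (algebraMap K R k) = algebraMap K S k) ∧
      IsQuotientByIdem R e S φ ∧
      ∃ _ : Module S M, (∀ (r : R) (m : M), φ r • m = r • m) ∧ IsTauTilting S K M

/-- `M` is a support τ⁻¹-tilting module: `M` is a τ⁻¹-tilting module over `Λ/(e)`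
for some idempotent `e`. -/
def IsSuppTauInvTilting (M : Type u) [AddCommGroup M] [Module R M] [Module K M] : Prop :=
  ∃ e : R, IsIdempotentElem e ∧
    ∃ (S : Type u) (_ : Ring S) (_ : Algebra K S) (φ : R →+* S),
      (∀ k : K, φ (algebraMap K R k) = algebraMap K S k) ∧
      IsQuotientByIdem R e S φ ∧
      ∃ _ : Module S M, (∀ (r : R) (m : M), φ r • m = r • m) ∧
        ∃ _ : IsScalarTower K S M, IsTauInvTilting S K M

end Support

section Torsion

variable (R : Type u) [Ring R]

/-- A class of modules is closed under isomorphism. -/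
def RespectsIso (T : ModuleCat.{u} R → Prop) : Prop :=
  ∀ X Y : ModuleCat.{u} R, Nonempty (X ≃ₗ[R] Y) → T X → T Y

/-- `(T, F)` is a torsion pair in the category of finitely generated `R`-modules. -/
def IsTorsionPair (T F : ModuleCat.{u} R → Prop) : Prop :=
  RespectsIso R T ∧ RespectsIso R F ∧
  (∀ X, T X → Module.Finite R X) ∧ (∀ X, F X → Module.Finite R X) ∧
  (∀ X Y : ModuleCat.{u} R, T X → F Y → ∀ f : X →ₗ[R] Y, f = 0) ∧
  (∀ X : ModuleCat.{u} R, Module.Finite R X →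
    ∃ t : Submodule R X, T (ModuleCat.of R t) ∧ F (ModuleCat.of R (X ⧸ t)))

/-- `T` is covariantly finite: every finitely generated module admits a left
`T`-approximation. -/
def CovariantlyFinite (T : ModuleCat.{u} R → Prop) : Prop :=
  ∀ X : ModuleCat.{u} R, Module.Finite R X →
    ∃ (M : ModuleCat.{u} R) (f : X →ₗ[R] M), T M ∧
      ∀ (M' : ModuleCat.{u} R) (g : X →ₗ[R] M'), T M' → ∃ h : M →ₗ[R] M', h.comp f = g

/-- `T` is contravariantly finite: every finitely generated module admits a right
`T`-approximation. -/
def ContravariantlyFinite (T : ModuleCat.{u} R → Prop) : Prop :=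
  ∀ X : ModuleCat.{u} R, Module.Finite R X →
    ∃ (M : ModuleCat.{u} R) (f : M →ₗ[R] X), T M ∧
      ∀ (M' : ModuleCat.{u} R) (g : M' →ₗ[R] X), T M' → ∃ h : M' →ₗ[R] M, f.comp h = g

/-- A functorially finite class. -/
def FunctoriallyFinite (T : ModuleCat.{u} R → Prop) : Prop :=
  CovariantlyFinite R T ∧ ContravariantlyFinite R T

/-- `G` is the basic Ext-projective generator of the torsion class `T`:
`G ∈ T` is basic, Ext-projective in `T`, `T = Fac G`, and every Ext-projective
module in `T` lies in `add G`. -/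
def IsBasicExtProjGen (T : ModuleCat.{u} R → Prop) (G : ModuleCat.{u} R) : Prop :=
  T G ∧ IsBasic R G ∧ (∀ X : ModuleCat.{u} R, T X → Ext1Vanishes R G X) ∧
  (∀ X : ModuleCat.{u} R, T X ↔ (Module.Finite R X ∧ FacOf R G X)) ∧
  (∀ X : ModuleCat.{u} R, T X → (∀ Y : ModuleCat.{u} R, T Y → Ext1Vanishes R X Y) →
    InAdd R G X)

/-- `C` is the basic Ext-injective cogenerator of the torsion-free class `F`:
`C ∈ F` is basic, Ext-injective in `F`, `F = Sub C`, and every Ext-injective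
module in `F` lies in `add C`. -/
def IsBasicExtInjCogen (F : ModuleCat.{u} R → Prop) (C : ModuleCat.{u} R) : Prop :=
  F C ∧ IsBasic R C ∧ (∀ X : ModuleCat.{u} R, F X → Ext1Vanishes R X C) ∧
  (∀ X : ModuleCat.{u} R, F X ↔ (Module.Finite R X ∧ SubOf R C X)) ∧
  (∀ X : ModuleCat.{u} R, F X → (∀ Y : ModuleCat.{u} R, F Y → Ext1Vanishes R Y X) →
    InAdd R C X)

variable (K : Type u) [Field K] [Algebra K R]

/-- A (functorially finite) Gorenstein torsion pair: the basic Ext-projective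
generator of `T` is Gorenstein projective. -/
def IsGorensteinTP (T F : ModuleCat.{u} R → Prop) : Prop :=
  IsTorsionPair R T F ∧ FunctoriallyFinite R T ∧
    ∀ G : ModuleCat.{u} R, IsBasicExtProjGen R T G → IsGP R G

/-- A trivial torsion pair: the basic Ext-projective generator of `T` is projective. -/
def IsTrivialTP (T F : ModuleCat.{u} R → Prop) : Prop :=
  IsTorsionPair R T F ∧ FunctoriallyFinite R T ∧
    ∀ G : ModuleCat.{u} R, IsBasicExtProjGen R T G → Module.Projective R G

end Torsion

section Misc

variable (R : Type u) [Ring R] (K : Type u) [Field K] [Algebra K R]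

/-- A projective cover `π : P → M`. -/
structure ProjCover (M : Type u) [AddCommGroup M] [Module R M] : Type (u + 1) where
  P : Type u
  [acg : AddCommGroup P]
  [mod : Module R P]
  fin : Module.Finite R P
  proj : Module.Projective R P
  π : P →ₗ[R] M
  surj : Function.Surjective π
  min : IsSuperfluous R (LinearMap.ker π)

attribute [instance] ProjCover.acg ProjCover.mod

/-- The canonical evaluation map `M → M** = Hom_{Rᵐᵒᵖ}(Hom_R(M, R), Rᵐᵒᵖ)`. -/
def bidualEval (M : Type u) [AddCommGroup M] [Module R M] (m : M) :
    (M →ₗ[R] R) →ₗ[Rᵐᵒᵖ] Rᵐᵒᵖ where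
  toFun f := op (f m)
  map_add' f g := by simp
  map_smul' s f := rfl

/-- `R` is CM-τ-tilting finite: up to isomorphism there are only finitely many
indecomposable Gorenstein projective τ-rigid modules. -/
def CMTauTiltingFinite : Prop :=
  ∃ (n : ℕ) (V : Fin n → ModuleCat.{u} R),
    ∀ (M : Type u) [AddCommGroup M] [Module R M], Module.Finite R M →
      IsIndec R M → IsGP R M → IsTauRigid R K M → ∃ i, Nonempty (M ≃ₗ[R] V i)

/-- `R` is CM-finite: up to isomorphism there are only finitely many
indecomposable Gorenstein projective modules. -/
def CMFinite : Prop :=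
  ∃ (n : ℕ) (V : Fin n → ModuleCat.{u} R),
    ∀ (M : Type u) [AddCommGroup M] [Module R M], Module.Finite R M →
      IsIndec R M → IsGP R M → ∃ i, Nonempty (M ≃ₗ[R] V i)

/-- `T` is the Bongartz completion of the τ-rigid module `M`: the basic
Ext-projective generator of `⊥(τM)`, with `⊥(τM) = Fac T`. -/
def IsBongartzCompletion (M : Type u) [AddCommGroup M] [Module R M]
    (T : Type u) [AddCommGroup T] [Module R T] : Prop :=
  Module.Finite R T ∧ IsBasic R T ∧ InPerpTau R K M T ∧
  (∀ (X : Type u) [AddCommGroup X] [Module R X], Module.Finite R X →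
    InPerpTau R K M X → Ext1Vanishes R T X) ∧
  (∀ (X : Type u) [AddCommGroup X] [Module R X], Module.Finite R X →
    (InPerpTau R K M X ↔ FacOf R T X))

end Misc

section HomologicalAlgebra

variable {R : Type u} [Ring R]

/-- A retract of an injective module is injective. -/
lemma injective_of_retract {X Y : Type u} [AddCommGroup X] [Module R X]
    [AddCommGroup Y] [Module R Y] (hY : Module.Injective R Y)
    (i : X →ₗ[R] Y) (p : Y →ₗ[R] X) (h : p.comp i = LinearMap.id) : Module.Injective R X := by
  constructor
  intro A B _ _ _ _ f hf g
  obtain ⟨k, hk⟩ := hY.out f hf (i.comp g)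
  refine ⟨p.comp k, fun x => ?_⟩
  have := LinearMap.congr_fun h (g x)
  simpa [hk] using this

/-- An injective map from an injective module splits. -/
lemma exists_retraction {X Y : Type u} [AddCommGroup X] [Module R X]
    [AddCommGroup Y] [Module R Y] (hX : Module.Injective R X)
    (i : X →ₗ[R] Y) (hi : Injective i) : ∃ p : Y →ₗ[R] X, p.comp i = LinearMap.id := by
  obtain ⟨p, hp⟩ := hX.out i hi LinearMap.id
  exact ⟨p, LinearMap.ext hp⟩

lemma injective_prod {X Y : Type u} [AddCommGroup X] [Module R X]
    [AddCommGroup Y] [Module R Y] (hX : Module.Injective R X) (hY : Module.Injective R Y) :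
    Module.Injective R (X × Y) := by
  constructor
  intro A B _ _ _ _ f hf g
  obtain ⟨k, hk⟩ := hX.out f hf ((LinearMap.fst R X Y).comp g)
  obtain ⟨l, hl⟩ := hY.out f hf ((LinearMap.snd R X Y).comp g)
  exact ⟨k.prod l, fun x => Prod.ext (by simp [hk]) (by simp [hl])⟩

/-- A linear map vanishing on the kernel of a surjection factors through it. -/
lemma exists_factor_of_ker_le {X Y Z : Type*} [AddCommGroup X] [Module R X]
    [AddCommGroup Y] [Module R Y] [AddCommGroup Z] [Module R Z]
    (p : X →ₗ[R] Y) (hp : Surjective p) (f : X →ₗ[R] Z)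
    (h : ∀ x, p x = 0 → f x = 0) : ∃ g : Y →ₗ[R] Z, g.comp p = f := by
  refine ⟨((LinearMap.ker p).liftQ f fun x hx => h x hx).comp
    (p.quotKerEquivOfSurjective hp).symm.toLinearMap, LinearMap.ext fun x => ?_⟩
  have : (p.quotKerEquivOfSurjective hp).symm (p x) = (LinearMap.ker p).mkQ x := by
    rw [LinearEquiv.symm_apply_eq]; rfl
  rw [LinearMap.comp_apply, LinearMap.comp_apply, LinearEquiv.coe_coe, this]
  exact Submodule.liftQ_apply _ _ _

/-- A linear map landing in the range of an injection factors through it. -/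
lemma exists_factor_of_range_le {X Y Z : Type*} [AddCommGroup X] [Module R X]
    [AddCommGroup Y] [Module R Y] [AddCommGroup Z] [Module R Z]
    (i : Y →ₗ[R] Z) (hi : Injective i) (f : X →ₗ[R] Z)
    (h : ∀ x, ∃ y, i y = f x) : ∃ g : X →ₗ[R] Y, i.comp g = f := by
  refine ⟨(LinearEquiv.ofInjective i hi).symm.toLinearMap.comp (f.codRestrict _ h),
    LinearMap.ext fun x => ?_⟩
  have := LinearEquiv.apply_symm_apply (LinearEquiv.ofInjective i hi) (f.codRestrict _ h x)
  exact congrArg Subtype.val this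

/-- If every map from `P₁` killing the kernel of `b` extends to `P₀`, then `Ext¹` vanishes. -/
lemma ext1Vanishes_of_extends {P₁ P₀ M Y : Type u} [AddCommGroup P₁] [Module R P₁]
    [AddCommGroup P₀] [Module R P₀] [AddCommGroup M] [Module R M] [AddCommGroup Y] [Module R Y]
    (hP : Module.Projective R P₀) (b : P₁ →ₗ[R] P₀) (p : P₀ →ₗ[R] M) (hp : Surjective p)
    (hbp : Function.Exact b p)
    (hext : ∀ w : P₁ →ₗ[R] Y, (∀ x, b x = 0 → w x = 0) → ∃ h : P₀ →ₗ[R] Y, h.comp b = w) :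
    Ext1Vanishes R M Y := by
  intro E _ _ i q hi hq hiq
  obtain ⟨v, hv⟩ := Module.projective_lifting_property q p hq
  have hvx : ∀ x, q (v x) = p x := fun x => LinearMap.congr_fun hv x
  obtain ⟨w, hw⟩ := exists_factor_of_range_le i hi (v.comp b) fun x => by
    refine (hiq _).1 ?_
    simp only [LinearMap.comp_apply, hvx]
    exact (hbp _).2 ⟨x, rfl⟩
  obtain ⟨h, hh⟩ := hext w fun x hx => hi (by
    have := LinearMap.congr_fun hw x
    simp only [LinearMap.comp_apply, hx, map_zero] at this
    rw [this, map_zero])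
  obtain ⟨s, hs⟩ := exists_factor_of_ker_le p hp (v - i.comp h) fun x hx => by
    obtain ⟨y, rfl⟩ := (hbp x).1 hx
    have h1 := LinearMap.congr_fun hw y
    have h2 := LinearMap.congr_fun hh y
    simp only [LinearMap.comp_apply] at h1 h2
    simp [h2, h1]
  refine ⟨s, LinearMap.ext fun m => ?_⟩
  obtain ⟨x, rfl⟩ := hp m
  have := LinearMap.congr_fun hs x
  simp only [LinearMap.comp_apply, LinearMap.sub_apply] at this
  simp [this, hvx, (hiq (i (h x))).2 ⟨_, rfl⟩]

/-- Maps from `X` lift along extensions by `Y` when `Ext¹(X, Y) = 0`. -/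
lemma Ext1Vanishes.exists_lift {X Y E Z : Type u} [AddCommGroup X] [Module R X]
    [AddCommGroup Y] [Module R Y] [AddCommGroup E] [Module R E] [AddCommGroup Z] [Module R Z]
    (hX : Ext1Vanishes R X Y) (i : Y →ₗ[R] E) (p : E →ₗ[R] Z) (hi : Injective i)
    (hp : Surjective p) (hip : Function.Exact i p) (f : X →ₗ[R] Z) :
    ∃ g : X →ₗ[R] E, p.comp g = f := by
  let W : Submodule R (E × X) := LinearMap.eqLocus (p.comp (LinearMap.fst R E X))
    (f.comp (LinearMap.snd R E X))
  have hW : ∀ w : W, p w.1.1 = f w.1.2 := fun w => w.2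
  let j : Y →ₗ[R] W := (i.prod 0).codRestrict W fun y => by
    change p (i y) = f 0
    rw [(hip _).2 ⟨y, rfl⟩, map_zero]
  obtain ⟨s, hs⟩ := hX W j ((LinearMap.snd R E X).comp W.subtype)
    (fun a b hab => hi (congrArg (fun w : W => w.1.1) hab))
    (fun x => by
      obtain ⟨e, he⟩ := hp (f x)
      exact ⟨⟨(e, x), he⟩, rfl⟩)
    (fun w => by
      constructor
      · intro hw
        have h0 : w.1.2 = 0 := hw
        obtain ⟨y, hy⟩ := (hip w.1.1).1 (by rw [hW w, h0, map_zero])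
        exact ⟨y, Subtype.ext (Prod.ext hy h0.symm)⟩
      · rintro ⟨y, rfl⟩
        rfl)
  refine ⟨((LinearMap.fst R E X).comp W.subtype).comp s, LinearMap.ext fun x => ?_⟩
  have := LinearMap.congr_fun hs x
  simp only [LinearMap.comp_apply, LinearMap.id_apply] at this
  change p (s x).1.1 = f x
  rw [hW]
  exact congrArg f this

/-- Maps from the kernel of `J → X` to `M` extend to `J` when `Ext¹(X, M) = 0`. -/
lemma Ext1Vanishes.exists_extend {X M J Y : Type u} [AddCommGroup X] [Module R X]
    [AddCommGroup M] [Module R M] [AddCommGroup J] [Module R J] [AddCommGroup Y] [Module R Y]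
    (hX : Ext1Vanishes R X M) (i : Y →ₗ[R] J) (p : J →ₗ[R] X) (hi : Injective i)
    (hp : Surjective p) (hip : Function.Exact i p) (f : Y →ₗ[R] M) :
    ∃ g : J →ₗ[R] M, g.comp i = f := by
  let N : Submodule R (J × M) := LinearMap.range (i.prod (-f))
  let q : ((J × M) ⧸ N) →ₗ[R] X := N.liftQ (p.comp (LinearMap.fst R J M)) (by
    rintro _ ⟨y, rfl⟩
    exact (hip _).2 ⟨y, rfl⟩)
  let j : M →ₗ[R] ((J × M) ⧸ N) := N.mkQ.comp (LinearMap.inr R J M)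
  have hj : Injective j := by
    rw [← LinearMap.ker_eq_bot, LinearMap.ker_eq_bot']
    intro m hm
    have hm' : ((0 : J), m) ∈ N := (Submodule.Quotient.mk_eq_zero N).1 hm
    obtain ⟨y, hy⟩ := hm'
    have hy0 : y = 0 := hi (by simpa using congrArg Prod.fst hy)
    have := congrArg Prod.snd hy
    simpa [hy0] using this.symm
  have hjq : Function.Exact j q := by
    intro e
    obtain ⟨⟨a, m⟩, rfl⟩ := N.mkQ_surjective e
    constructor
    · intro ha
      obtain ⟨y, rfl⟩ := (hip a).1 ha
      refine ⟨m + f y, ?_⟩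
      refine ((Submodule.Quotient.eq N).2 ⟨-y, ?_⟩)
      simp
    · rintro ⟨m', hm'⟩
      rw [← hm']
      exact map_zero p
  obtain ⟨s, hs⟩ := hX _ j q hj (fun x => by
    obtain ⟨a, rfl⟩ := hp x
    exact ⟨N.mkQ (a, 0), rfl⟩) hjq
  obtain ⟨r, hr⟩ := exists_factor_of_range_le j hj (LinearMap.id - s.comp q) fun e => by
    refine (hjq _).1 ?_
    have := LinearMap.congr_fun hs (q e)
    simp only [LinearMap.comp_apply, LinearMap.id_apply] at this
    simp [this]
  refine ⟨r.comp (N.mkQ.comp (LinearMap.inl R J M)), LinearMap.ext fun y => hj ?_⟩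
  have h1 : N.mkQ (i y, 0) = j (f y) := (Submodule.Quotient.eq N).2 ⟨y, by simp⟩
  have h2 := LinearMap.congr_fun hr (N.mkQ (i y, 0))
  have h3 : q (N.mkQ (i y, 0)) = 0 := (hip _).2 ⟨y, rfl⟩
  simp only [LinearMap.comp_apply, LinearMap.sub_apply, LinearMap.id_apply, h3, map_zero,
    sub_zero] at h2
  simp only [LinearMap.comp_apply, LinearMap.inl_apply]
  rw [h2, h1]

lemma Ext1Vanishes.of_inAdd {G X Y : Type u} [AddCommGroup G] [Module R G]
    [AddCommGroup X] [Module R X] [AddCommGroup Y] [Module R Y]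
    (hX : InAdd R G X) (hG : Ext1Vanishes R G Y) : Ext1Vanishes R X Y := by
  obtain ⟨n, i, p, hpi⟩ := hX
  intro E _ _ j q hj hq hjq
  choose g hg using fun k : Fin n => hG.exists_lift j q hj hq hjq
    (p.comp (LinearMap.single R (fun _ => G) k))
  refine ⟨(∑ k, (g k).comp (LinearMap.proj k)).comp i, LinearMap.ext fun x => ?_⟩
  have h1 : ∀ k y, q (g k y) = p (Pi.single k y) := fun k y => LinearMap.congr_fun (hg k) y
  have h2 := LinearMap.congr_fun hpi x
  simp only [LinearMap.comp_apply, LinearMap.id_apply] at h2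
  simp only [LinearMap.comp_apply, LinearMap.sum_apply, map_sum, LinearMap.proj_apply, h1,
    LinearMap.id_apply]
  rw [← map_sum, Finset.univ_sum_single, h2]

/-- If `M` has a projective resolution of length one, then the first differential of a minimal
projective presentation of `M` is injective. -/
lemma MinPres.d_injective {M Q₁ Q₀ : Type u} [AddCommGroup M] [Module R M]
    [AddCommGroup Q₁] [Module R Q₁] [AddCommGroup Q₀] [Module R Q₀] (pr : MinPres R M)
    (hQ₁ : Module.Projective R Q₁) (hQ₀ : Module.Projective R Q₀)
    (j : Q₁ →ₗ[R] Q₀) (q : Q₀ →ₗ[R] M) (hj : Injective j) (hq : Surjective q)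
    (hjq : Function.Exact j q) : Injective pr.d := by
  have hP₀ := pr.proj₀
  have hex := pr.exact
  obtain ⟨a, ha⟩ := Module.projective_lifting_property q pr.p hq
  obtain ⟨b, hb⟩ := Module.projective_lifting_property pr.p q pr.surj
  have ha' : ∀ x, q (a x) = pr.p x := fun x => LinearMap.congr_fun ha x
  have hb' : ∀ x, pr.p (b x) = q x := fun x => LinearMap.congr_fun hb x
  let L := LinearMap.ker pr.p
  obtain ⟨c, hc⟩ := exists_factor_of_range_le j hj (a.comp L.subtype) fun x => by
    refine (hjq _).1 ?_
    simp only [LinearMap.comp_apply, ha']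
    exact x.2
  have hc' : ∀ x : L, j (c x) = a x := fun x => LinearMap.congr_fun hc x
  let e : Q₁ →ₗ[R] L := (b.comp j).codRestrict L fun x => by
    change pr.p (b (j x)) = 0
    rw [hb']; exact (hjq _).2 ⟨x, rfl⟩
  let f : pr.P₀ →ₗ[R] L := (LinearMap.id - b.comp a).codRestrict L fun x => by
    change pr.p (x - b (a x)) = 0
    rw [map_sub, hb', ha', sub_self]
  have hL : Module.Projective R L := Module.Projective.of_split (L.subtype.prod c) (f.coprod e) (by
    ext x
    have := hc' x
    simp [e, f, this])
  obtain ⟨s, hs⟩ := LinearMap.exists_rightInverse_of_surjective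
    (pr.d.codRestrict L fun x => (hex _).2 ⟨x, rfl⟩) (by
      rw [LinearMap.range_eq_top]
      intro x
      obtain ⟨y, hy⟩ := (hex _).1 x.2
      exact ⟨y, Subtype.ext hy⟩)
  have hs' : ∀ x : L, pr.d (s x) = x := fun x => congrArg Subtype.val (LinearMap.congr_fun hs x)
  have htop : LinearMap.range s = ⊤ := by
    refine pr.min₁ _ (eq_top_iff.2 fun x _ => ?_)
    have hx : pr.d x ∈ L := (hex _).2 ⟨x, rfl⟩
    rw [← sub_add_cancel x (s ⟨pr.d x, hx⟩)]
    refine Submodule.add_mem_sup ?_ ⟨_, rfl⟩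
    rw [LinearMap.mem_ker, map_sub, hs', sub_self]
  rw [← LinearMap.ker_eq_bot, LinearMap.ker_eq_bot']
  intro x hx
  obtain ⟨y, rfl⟩ := LinearMap.range_eq_top.1 htop x
  rw [hs'] at hx
  rw [show y = 0 from Subtype.ext hx, map_zero]

/-- A right linear functional on the dual of a finitely generated projective module is
evaluation at a vector. -/
lemma exists_eval_of_projective {P : Type u} [AddCommGroup P] [Module R P]
    [Module.Finite R P] [Module.Projective R P] (f : (P →ₗ[R] R) →+ R)
    (hf : ∀ (s : R) g, f (op s • g) = f g * s) : ∃ x : P, ∀ g, f g = g x := by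
  obtain ⟨n, p, hp⟩ := Module.Finite.exists_fin' R P
  obtain ⟨s, hs⟩ := LinearMap.exists_rightInverse_of_surjective p (LinearMap.range_eq_top.2 hp)
  let c : Fin n → (P →ₗ[R] R) := fun k => (LinearMap.proj k).comp s
  let v : Fin n → P := fun k => p (Pi.single k 1)
  have hexp : ∀ x, x = ∑ k, c k x • v k := fun x => by
    have h1 := LinearMap.congr_fun hs x
    simp only [LinearMap.comp_apply, LinearMap.id_apply] at h1
    conv_lhs => rw [← h1, pi_eq_sum_univ' (s x)]
    simp [c, v, map_sum]
  refine ⟨∑ k, f (c k) • v k, fun g => ?_⟩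
  have hg : g = ∑ k, op (g (v k)) • c k := by
    ext x
    conv_lhs => rw [hexp x]
    simp
  conv_lhs => rw [hg]
  simp [map_sum, hf]

/-- If the minimal presentation is injective then there are no nonzero right linear maps from the
transpose to the ring. -/
lemma MinPres.Tr_hom_eq_zero {M : Type u} [AddCommGroup M] [Module R M] (pr : MinPres R M)
    (hd : Injective pr.d) (f : pr.Tr →+ R) (hf : ∀ (s : R) x, f (op s • x) = f x * s) : f = 0 := by
  have := pr.fin₁
  have := pr.proj₁
  have hP₀ := pr.proj₀
  obtain ⟨x, hx⟩ := exists_eval_of_projective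
    (f.comp (LinearMap.range pr.dualMap).mkQ.toAddMonoidHom) fun s g => hf s (pr.toTr g)
  have hx' : ∀ g, f (pr.toTr g) = g x := hx
  have hq : ∀ q : pr.P₀ →ₗ[R] R, q (pr.d x) = 0 := fun q => by
    have h1 : pr.toTr (pr.dualMap q) = 0 := (Submodule.Quotient.mk_eq_zero _).2 ⟨q, rfl⟩
    have h2 := hx' (pr.dualMap q)
    rw [h1, map_zero] at h2
    exact h2.symm
  have hx0 : x = 0 := hd (by rw [map_zero, (Module.forall_dual_apply_eq_zero_iff R _).1 hq])
  ext t
  obtain ⟨g, rfl⟩ := (LinearMap.range pr.dualMap).mkQ_surjective t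
  change f (pr.toTr g) = 0
  rw [hx', hx0, map_zero]

end HomologicalAlgebra

section Duality

variable (R : Type u) [Ring R] (K : Type u) [Field K] [Algebra K R]

/-- The dual of a map of right modules. -/
def OpDual.map {M N : Type u} [AddCommGroup M] [Module Rᵐᵒᵖ M] [Module K M]
    [IsScalarTower K Rᵐᵒᵖ M] [AddCommGroup N] [Module Rᵐᵒᵖ N] [Module K N]
    [IsScalarTower K Rᵐᵒᵖ N] (f : M →ₗ[Rᵐᵒᵖ] N) : OpDual R K N →ₗ[R] OpDual R K M where
  toFun φ := (OpDual.toL R K N φ).comp (f.restrictScalars K)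
  map_add' _ _ := rfl
  map_smul' r φ := OpDual.toL_injective R K M <| LinearMap.ext fun x =>
    congrArg (OpDual.toL R K N φ) (f.map_smul (op r) x).symm

/-- The dual of a map of left modules. -/
def LDual.map {M N : Type u} [AddCommGroup M] [Module R M] [Module K M]
    [IsScalarTower K R M] [AddCommGroup N] [Module R N] [Module K N]
    [IsScalarTower K R N] (f : M →ₗ[R] N) : LDual R K N →ₗ[Rᵐᵒᵖ] LDual R K M where
  toFun φ := (LDual.toL R K N φ).comp (f.restrictScalars K)
  map_add' _ _ := rfl
  map_smul' r φ := LDual.toL_injective R K M <| LinearMap.ext fun x =>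
    congrArg (LDual.toL R K N φ) (f.map_smul (unop r) x).symm

variable {K} in
lemma exists_comp_eq_of_injective {M N : Type*} [AddCommGroup M] [Module K M] [AddCommGroup N]
    [Module K N] (f : M →ₗ[K] N) (hf : Injective f) (φ : M →ₗ[K] K) :
    ∃ ψ : N →ₗ[K] K, ψ.comp f = φ := by
  obtain ⟨g, hg⟩ := f.exists_leftInverse_of_injective (LinearMap.ker_eq_bot.2 hf)
  exact ⟨φ.comp g, by rw [LinearMap.comp_assoc, hg, LinearMap.comp_id]⟩

section OpMap

variable {A B C : Type u} [AddCommGroup A] [Module Rᵐᵒᵖ A] [Module K A] [IsScalarTower K Rᵐᵒᵖ A]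
  [AddCommGroup B] [Module Rᵐᵒᵖ B] [Module K B] [IsScalarTower K Rᵐᵒᵖ B]
  [AddCommGroup C] [Module Rᵐᵒᵖ C] [Module K C] [IsScalarTower K Rᵐᵒᵖ C]

lemma OpDual.map_surjective (f : A →ₗ[Rᵐᵒᵖ] B) (hf : Injective f) :
    Surjective (OpDual.map R K f) := fun φ =>
  exists_comp_eq_of_injective (f.restrictScalars K) hf (OpDual.toL R K A φ)

lemma OpDual.map_injective (f : A →ₗ[Rᵐᵒᵖ] B) (hf : Surjective f) :
    Injective (OpDual.map R K f) := fun φ ψ h => OpDual.toL_injective R K B <|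
  LinearMap.ext fun b => by
    obtain ⟨a, rfl⟩ := hf b
    exact LinearMap.congr_fun (congrArg (OpDual.toL R K A) h) a

lemma OpDual.map_exact (f : A →ₗ[Rᵐᵒᵖ] B) (g : B →ₗ[Rᵐᵒᵖ] C) (hg : Surjective g)
    (h : Function.Exact f g) : Function.Exact (OpDual.map R K g) (OpDual.map R K f) := by
  intro φ
  constructor
  · intro hφ
    refine exists_factor_of_ker_le (g.restrictScalars K) hg (OpDual.toL R K B φ) fun b hb => ?_
    obtain ⟨a, rfl⟩ := (h b).1 hb
    exact LinearMap.congr_fun (congrArg (OpDual.toL R K A) hφ) a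
  · rintro ⟨ψ, rfl⟩
    refine OpDual.toL_injective R K A <| LinearMap.ext fun a => ?_
    change OpDual.toL R K C ψ (g (f a)) = 0
    rw [h.apply_apply_eq_zero, map_zero]

end OpMap

section LMap

variable {A B C : Type u} [AddCommGroup A] [Module R A] [Module K A] [IsScalarTower K R A]
  [AddCommGroup B] [Module R B] [Module K B] [IsScalarTower K R B]
  [AddCommGroup C] [Module R C] [Module K C] [IsScalarTower K R C]

lemma LDual.map_surjective (f : A →ₗ[R] B) (hf : Injective f) :
    Surjective (LDual.map R K f) := fun φ =>
  exists_comp_eq_of_injective (f.restrictScalars K) hf (LDual.toL R K A φ)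

lemma LDual.map_injective (f : A →ₗ[R] B) (hf : Surjective f) :
    Injective (LDual.map R K f) := fun φ ψ h => LDual.toL_injective R K B <|
  LinearMap.ext fun b => by
    obtain ⟨a, rfl⟩ := hf b
    exact LinearMap.congr_fun (congrArg (LDual.toL R K A) h) a

lemma LDual.map_exact (f : A →ₗ[R] B) (g : B →ₗ[R] C) (hg : Surjective g)
    (h : Function.Exact f g) : Function.Exact (LDual.map R K g) (LDual.map R K f) := by
  intro φ
  constructor
  · intro hφ
    refine exists_factor_of_ker_le (g.restrictScalars K) hg (LDual.toL R K B φ) fun b hb => ?_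
    obtain ⟨a, rfl⟩ := (h b).1 hb
    exact LinearMap.congr_fun (congrArg (LDual.toL R K A) hφ) a
  · rintro ⟨ψ, rfl⟩
    refine LDual.toL_injective R K A <| LinearMap.ext fun a => ?_
    change LDual.toL R K C ψ (g (f a)) = 0
    rw [h.apply_apply_eq_zero, map_zero]

end LMap

variable {K} in
lemma exists_eval_of_dual {V : Type*} [AddCommGroup V] [Module K V] [FiniteDimensional K V]
    (f : Module.Dual K V →ₗ[K] K) : ∃ v : V, ∀ ξ : Module.Dual K V, ξ v = f ξ :=
  ⟨(Module.evalEquiv K V).symm f, fun ξ => LinearMap.congr_fun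
    ((Module.evalEquiv K V).apply_symm_apply f) ξ⟩

variable {K} in
lemma eq_of_forall_dual {V : Type*} [AddCommGroup V] [Module K V] {v w : V}
    (h : ∀ ξ : Module.Dual K V, ξ v = ξ w) : v = w := by
  rw [← sub_eq_zero, ← Module.forall_dual_apply_eq_zero_iff K]
  exact fun ξ => by rw [map_sub, h, sub_self]

/-- The dual of the regular right module is injective. -/
lemma opDual_self_injective : Module.Injective R (OpDual R K R) := by
  refine Module.Baer.injective fun J g => ?_
  let lam : J.restrictScalars K →ₗ[K] K :=
    { toFun := fun x => OpDual.toL R K R (g x) 1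
      map_add' := fun x y => by
        rw [show g (x + y) = g x + g y from map_add g _ _]; rfl
      map_smul' := fun k x => by
        have : g (k • x : J.restrictScalars K) = k • g x := by
          rw [← algebraMap_smul R k (g x)]
          exact (congrArg g (Subtype.ext (algebraMap_smul R k (x : R)).symm)).trans
            (g.map_smul (algebraMap K R k) x)
        rw [this]; rfl }
  obtain ⟨μ, hμ⟩ := LinearMap.exists_extend lam
  refine ⟨LinearMap.toSpanSingleton R _ (show OpDual R K R from μ), fun x hx => ?_⟩
  refine OpDual.toL_injective R K R <| LinearMap.ext fun r => ?_
  have h1 := LinearMap.congr_fun hμ (⟨r * x, J.mul_mem_left r hx⟩ : J.restrictScalars K)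
  have h2 : g ⟨r * x, J.mul_mem_left r hx⟩ = r • g ⟨x, hx⟩ := by rw [← map_smul]; rfl
  change μ (r * x) = _
  refine h1.trans ?_
  change OpDual.toL R K R (g ⟨r * x, J.mul_mem_left r hx⟩) 1 = _
  rw [h2, OpDual.smul_toL, op_smul_eq_mul, one_mul]

variable [FiniteDimensional K R]

/-- The dual of a finitely generated injective right module is projective. -/
lemma OpDual.projective_of_injective (I : Type u) [AddCommGroup I] [Module Rᵐᵒᵖ I] [Module K I]
    [IsScalarTower K Rᵐᵒᵖ I] [FiniteDimensional K I] (hI : Module.Injective Rᵐᵒᵖ I) :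
    Module.Finite R (OpDual R K I) ∧ Module.Projective R (OpDual R K I) := by
  have : Module.Finite K (OpDual R K I) := inferInstanceAs (Module.Finite K (I →ₗ[K] K))
  have hfin : Module.Finite R (OpDual R K I) := Module.Finite.of_restrictScalars_finite K R _
  refine ⟨hfin, ?_⟩
  obtain ⟨n, q, hq⟩ := Module.Finite.exists_fin' R (OpDual R K I)
  let Ξ : I →ₗ[Rᵐᵒᵖ] LDual R K (Fin n → R) :=
    { toFun := fun x =>
        { toFun := fun v => OpDual.toL R K I (q v) x
          map_add' := fun v w => by rw [map_add]; rfl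
          map_smul' := fun k v => by
            rw [← algebraMap_smul R k v, map_smul, algebraMap_smul]; rfl }
      map_add' := fun x y => LDual.toL_injective R K _ <| LinearMap.ext fun v =>
        map_add (OpDual.toL R K I (q v)) x y
      map_smul' := fun r x => LDual.toL_injective R K _ <| LinearMap.ext fun v => by
        change OpDual.toL R K I (q v) (r • x) = OpDual.toL R K I (q (unop r • v)) x
        rw [q.map_smul]; rfl }
  have hΞ : ∀ x v, LDual.toL R K _ (Ξ x) v = OpDual.toL R K I (q v) x := fun _ _ => rfl
  obtain ⟨ρ, hρ⟩ := exists_retraction hI Ξ fun x y hxy => eq_of_forall_dual fun ξ => by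
    obtain ⟨v, rfl⟩ := hq ξ
    exact LinearMap.congr_fun (congrArg (LDual.toL R K _) hxy) v
  choose s hs using fun φ : OpDual R K I =>
    exists_eval_of_dual (V := Fin n → R) ((OpDual.toL R K I φ).comp (ρ.restrictScalars K))
  have hs' : ∀ φ (ξ : LDual R K (Fin n → R)),
    LDual.toL R K _ ξ (s φ) = OpDual.toL R K I φ (ρ ξ) := hs
  let σ : OpDual R K I →ₗ[R] (Fin n → R) :=
    { toFun := s
      map_add' := fun φ ψ => eq_of_forall_dual fun ξ => by
        have h1 := hs' (φ + ψ) ξ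
        have h2 := hs' φ ξ
        have h3 := hs' ψ ξ
        rw [OpDual.toL_add, LinearMap.add_apply, ← h2, ← h3] at h1
        rw [map_add]; exact h1
      map_smul' := fun r φ => eq_of_forall_dual fun ξ => by
        have h1 := hs' (r • φ) ξ
        rw [OpDual.smul_toL] at h1
        have h2 := hs' φ (op r • (show LDual R K (Fin n → R) from ξ))
        rw [map_smul, ← h1] at h2
        exact h2.symm }
  refine Module.Projective.of_split σ q (LinearMap.ext fun φ =>
    OpDual.toL_injective R K I <| LinearMap.ext fun x => ?_)
  change OpDual.toL R K I (q (s φ)) x = OpDual.toL R K I φ x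
  rw [← hΞ, hs', show ρ (Ξ x) = x from LinearMap.congr_fun hρ x]

/-- The dual of a finitely generated injective left module is projective. -/
lemma LDual.projective_of_injective (I : Type u) [AddCommGroup I] [Module R I] [Module K I]
    [IsScalarTower K R I] [FiniteDimensional K I] (hI : Module.Injective R I) :
    Module.Finite Rᵐᵒᵖ (LDual R K I) ∧ Module.Projective Rᵐᵒᵖ (LDual R K I) := by
  have : Module.Finite K (LDual R K I) := inferInstanceAs (Module.Finite K (I →ₗ[K] K))
  have hfin : Module.Finite Rᵐᵒᵖ (LDual R K I) := Module.Finite.of_restrictScalars_finite K Rᵐᵒᵖ _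
  refine ⟨hfin, ?_⟩
  obtain ⟨n, q, hq⟩ := Module.Finite.exists_fin' Rᵐᵒᵖ (LDual R K I)
  let Ξ : I →ₗ[R] OpDual R K (Fin n → Rᵐᵒᵖ) :=
    { toFun := fun x =>
        { toFun := fun v => LDual.toL R K I (q v) x
          map_add' := fun v w => by rw [map_add]; rfl
          map_smul' := fun k v => by
            rw [← algebraMap_smul Rᵐᵒᵖ k v, map_smul, algebraMap_smul]; rfl }
      map_add' := fun x y => OpDual.toL_injective R K _ <| LinearMap.ext fun v =>
        map_add (LDual.toL R K I (q v)) x y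
      map_smul' := fun r x => OpDual.toL_injective R K _ <| LinearMap.ext fun v => by
        change LDual.toL R K I (q v) (r • x) = LDual.toL R K I (q (op r • v)) x
        rw [q.map_smul]; rfl }
  have hΞ : ∀ x v, OpDual.toL R K _ (Ξ x) v = LDual.toL R K I (q v) x := fun _ _ => rfl
  obtain ⟨ρ, hρ⟩ := exists_retraction hI Ξ fun x y hxy => eq_of_forall_dual fun ξ => by
    obtain ⟨v, rfl⟩ := hq ξ
    exact LinearMap.congr_fun (congrArg (OpDual.toL R K _) hxy) v
  choose s hs using fun φ : LDual R K I =>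
    exists_eval_of_dual (V := Fin n → Rᵐᵒᵖ) ((LDual.toL R K I φ).comp (ρ.restrictScalars K))
  have hs' : ∀ φ (ξ : OpDual R K (Fin n → Rᵐᵒᵖ)),
    OpDual.toL R K _ ξ (s φ) = LDual.toL R K I φ (ρ ξ) := hs
  let σ : LDual R K I →ₗ[Rᵐᵒᵖ] (Fin n → Rᵐᵒᵖ) :=
    { toFun := s
      map_add' := fun φ ψ => eq_of_forall_dual fun ξ => by
        have h1 := hs' (φ + ψ) ξ
        have h2 := hs' φ ξ
        have h3 := hs' ψ ξ
        rw [LDual.toL_add, LinearMap.add_apply, ← h2, ← h3] at h1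
        rw [map_add]; exact h1
      map_smul' := fun r φ => eq_of_forall_dual fun ξ => by
        have h1 := hs' (r • φ) ξ
        rw [LDual.smul_toL] at h1
        have h2 := hs' φ (unop r • (show OpDual R K (Fin n → Rᵐᵒᵖ) from ξ))
        rw [map_smul, ← h1] at h2
        exact h2.symm }
  refine Module.Projective.of_split σ q (LinearMap.ext fun φ =>
    LDual.toL_injective R K I <| LinearMap.ext fun x => ?_)
  change LDual.toL R K I (q (s φ)) x = LDual.toL R K I φ x
  rw [← hΞ, hs', show ρ (Ξ x) = x from LinearMap.congr_fun hρ x]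

instance finite_opDual_self : Module.Finite R (OpDual R K R) := by
  have : Module.Finite K (OpDual R K R) := inferInstanceAs (Module.Finite K (R →ₗ[K] K))
  exact Module.Finite.of_restrictScalars_finite K R _

/-- A finitely generated module embeds into a finite power of the dual of the regular module. -/
lemma exists_embedding_opDual (M : Type u) [AddCommGroup M] [Module R M] [Module.Finite R M] :
    ∃ (n : ℕ) (i : M →ₗ[R] (Fin n → OpDual R K R)), Injective i := by
  let _ : Module K M := Module.compHom M (algebraMap K R)
  have : IsScalarTower K R M := IsScalarTower.of_algebraMap_smul fun _ _ => rfl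
  have : Module.Finite K M := Module.Finite.trans R M
  obtain ⟨n, q, hq⟩ := Module.Finite.exists_fin' K (Module.Dual K M)
  let emb : Module.Dual K M → (M →ₗ[R] OpDual R K R) := fun ξ =>
    { toFun := fun m => ξ.comp ((LinearMap.toSpanSingleton R M m).restrictScalars K)
      map_add' := fun m m' => OpDual.toL_injective R K R <| LinearMap.ext fun r => by
        change ξ (r • (m + m')) = ξ (r • m) + ξ (r • m')
        rw [smul_add, map_add]
      map_smul' := fun s m => OpDual.toL_injective R K R <| LinearMap.ext fun r => by
        change ξ (r • s • m) = ξ ((r * s) • m)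
        rw [mul_smul] }
  have hemb : ∀ ξ m, OpDual.toL R K R (emb ξ m) 1 = ξ m := fun ξ m => congrArg ξ (one_smul R m)
  refine ⟨n, LinearMap.pi fun k => emb (q (Pi.single k 1)), ?_⟩
  rw [← LinearMap.ker_eq_bot, LinearMap.ker_eq_bot']
  intro m hm
  refine (Module.forall_dual_apply_eq_zero_iff K m).1 fun ξ => ?_
  obtain ⟨v, rfl⟩ := hq ξ
  rw [pi_eq_sum_univ' v, map_sum, LinearMap.sum_apply]
  refine Finset.sum_eq_zero fun k _ => ?_
  have h0 : q (Pi.single k 1) m = 0 := by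
    rw [← hemb, show emb (q (Pi.single k 1)) m = 0 from congrFun hm k]; rfl
  have h1 : q (v k • Pi.single k 1) m = 0 := by
    rw [map_smul, LinearMap.smul_apply, h0, smul_zero]
  convert h1 using 3

lemma inAdd_opDual_of_injective {I : Type u} [AddCommGroup I] [Module R I] [Module.Finite R I]
    (hI : Module.Injective R I) : InAdd R (OpDual R K R) I := by
  obtain ⟨n, i, hi⟩ := exists_embedding_opDual R K I
  obtain ⟨p, hp⟩ := exists_retraction hI i hi
  exact ⟨n, i, p, hp⟩

/-- If the regular right module has injective dimension at most one, then its dual has a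
projective resolution of length one. -/
lemma exists_resolution_opDual (h : SelfInjDimLE1 Rᵐᵒᵖ) :
    ∃ (Q₁ Q₀ : Type u) (_ : AddCommGroup Q₁) (_ : Module R Q₁) (_ : AddCommGroup Q₀)
      (_ : Module R Q₀) (j : Q₁ →ₗ[R] Q₀) (q : Q₀ →ₗ[R] OpDual R K R),
      Module.Finite R Q₁ ∧ Module.Projective R Q₁ ∧ Module.Projective R Q₀ ∧
      Injective j ∧ Surjective q ∧ Function.Exact j q := by
  obtain ⟨I₀, I₁, _, _, _, _, hf₀, hf₁, hI₀, hI₁, i, p, hi, hp, hip⟩ := h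
  let _ : Module K I₀ := Module.compHom I₀ (algebraMap K Rᵐᵒᵖ)
  have : IsScalarTower K Rᵐᵒᵖ I₀ := IsScalarTower.of_algebraMap_smul fun _ _ => rfl
  let _ : Module K I₁ := Module.compHom I₁ (algebraMap K Rᵐᵒᵖ)
  have : IsScalarTower K Rᵐᵒᵖ I₁ := IsScalarTower.of_algebraMap_smul fun _ _ => rfl
  have : Module.Finite K I₀ := Module.Finite.trans Rᵐᵒᵖ I₀
  have : Module.Finite K I₁ := Module.Finite.trans Rᵐᵒᵖ I₁
  let i' : R →ₗ[Rᵐᵒᵖ] I₀ :=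
    { toFun := fun r => i (op r)
      map_add' := fun r s => by rw [op_add, map_add]
      map_smul' := fun s r => by
        change i (s * op r) = _
        rw [← smul_eq_mul, map_smul]; rfl }
  have hip' : Function.Exact i' p := fun x =>
    (hip x).trans ⟨fun ⟨r, hr⟩ => ⟨unop r, hr⟩, fun ⟨r, hr⟩ => ⟨op r, hr⟩⟩
  exact ⟨OpDual R K I₁, OpDual R K I₀, inferInstance, inferInstance, inferInstance, inferInstance,
    OpDual.map R K p, OpDual.map R K i', (OpDual.projective_of_injective R K I₁ hI₁).1,
    (OpDual.projective_of_injective R K I₁ hI₁).2, (OpDual.projective_of_injective R K I₀ hI₀).2,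
    OpDual.map_injective R K p hp,
    OpDual.map_surjective R K i' fun a b hab => op_injective (hi hab),
    OpDual.map_exact R K i' p hp hip'⟩

/-- If the regular left module has injective dimension at most one, then its dual has a
projective resolution of length one. -/
lemma exists_resolution_lDual (h : SelfInjDimLE1 R) :
    ∃ (Q₁ Q₀ : Type u) (_ : AddCommGroup Q₁) (_ : Module Rᵐᵒᵖ Q₁) (_ : AddCommGroup Q₀)
      (_ : Module Rᵐᵒᵖ Q₀) (j : Q₁ →ₗ[Rᵐᵒᵖ] Q₀) (q : Q₀ →ₗ[Rᵐᵒᵖ] LDual R K R),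
      Module.Projective Rᵐᵒᵖ Q₁ ∧ Module.Projective Rᵐᵒᵖ Q₀ ∧
      Injective j ∧ Surjective q ∧ Function.Exact j q := by
  obtain ⟨I₀, I₁, _, _, _, _, hf₀, hf₁, hI₀, hI₁, i, p, hi, hp, hip⟩ := h
  let _ : Module K I₀ := Module.compHom I₀ (algebraMap K R)
  have : IsScalarTower K R I₀ := IsScalarTower.of_algebraMap_smul fun _ _ => rfl
  let _ : Module K I₁ := Module.compHom I₁ (algebraMap K R)
  have : IsScalarTower K R I₁ := IsScalarTower.of_algebraMap_smul fun _ _ => rfl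
  have : Module.Finite K I₀ := Module.Finite.trans R I₀
  have : Module.Finite K I₁ := Module.Finite.trans R I₁
  exact ⟨LDual R K I₁, LDual R K I₀, inferInstance, inferInstance, inferInstance, inferInstance,
    LDual.map R K p, LDual.map R K i, (LDual.projective_of_injective R K I₁ hI₁).2,
    (LDual.projective_of_injective R K I₀ hI₀).2,
    LDual.map_injective R K p hp, LDual.map_surjective R K i hi, LDual.map_exact R K i p hp hip⟩

end Duality

section Gorenstein

variable {R : Type u} [Ring R]

lemma exact_comp_right_of_injective {A B C J : Type u} [AddCommGroup A] [Module R A]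
    [AddCommGroup B] [Module R B] [AddCommGroup C] [Module R C] [AddCommGroup J] [Module R J]
    (hJ : Module.Injective R J) (f : A →ₗ[R] B) (g : B →ₗ[R] C) (hfg : Function.Exact f g) :
    Function.Exact (fun h : C →ₗ[R] J => h.comp g) (fun h : B →ₗ[R] J => h.comp f) := by
  intro h
  constructor
  · intro hh
    obtain ⟨k, hk⟩ := exists_factor_of_ker_le g.rangeRestrict g.surjective_rangeRestrict h
      fun b hb => by
        obtain ⟨a, rfl⟩ := (hfg b).1 (congrArg Subtype.val hb)
        exact LinearMap.congr_fun hh a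
    obtain ⟨l, hl⟩ := hJ.out (LinearMap.range g).subtype (Submodule.subtype_injective _) k
    refine ⟨l, LinearMap.ext fun b => ?_⟩
    exact (hl (g.rangeRestrict b)).trans (LinearMap.congr_fun hk b)
  · rintro ⟨k, rfl⟩
    ext a
    simp [hfg.apply_apply_eq_zero]

lemma exact_comp_left_of_projective {A B C Q : Type u} [AddCommGroup A] [Module R A]
    [AddCommGroup B] [Module R B] [AddCommGroup C] [Module R C] [AddCommGroup Q] [Module R Q]
    (hQ : Module.Projective R Q) (f : A →ₗ[R] B) (g : B →ₗ[R] C) (hfg : Function.Exact f g) :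
    Function.Exact (fun h : Q →ₗ[R] A => f.comp h) (fun h : Q →ₗ[R] B => g.comp h) := by
  intro h
  constructor
  · intro hh
    obtain ⟨k, hk⟩ := Module.projective_lifting_property f.rangeRestrict
      (h.codRestrict (LinearMap.range f) fun x => (hfg _).1 (LinearMap.congr_fun hh x))
      f.surjective_rangeRestrict
    refine ⟨k, LinearMap.ext fun b => ?_⟩
    exact congrArg Subtype.val (LinearMap.congr_fun hk b)
  · rintro ⟨k, rfl⟩
    ext a
    simp [hfg.apply_apply_eq_zero]

/-- Gorenstein projective modules have no extensions by finitely generated projective modules. -/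
lemma IsGP.ext1Vanishes {G Q : Type u} [AddCommGroup G] [Module R G] [AddCommGroup Q]
    [Module R Q] (hG : IsGP R G) [Module.Finite R Q] [Module.Projective R Q] :
    Ext1Vanishes R G Q := by
  obtain ⟨P, _, _, d, -, hproj, hex, hhom, ⟨e⟩⟩ := hG
  rw [show (-1 : ℤ) = -3 + 1 + 1 from rfl] at e
  generalize (-3 : ℤ) = n at e
  obtain ⟨m, q, hq⟩ := Module.Finite.exists_fin' R Q
  obtain ⟨s, hs⟩ := LinearMap.exists_rightInverse_of_surjective q (LinearMap.range_eq_top.2 hq)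
  refine ext1Vanishes_of_extends (hproj (n + 1 + 1)) (d (n + 1))
    (e.symm.toLinearMap.comp (d (n + 1 + 1)).rangeRestrict)
    (e.symm.surjective.comp (d (n + 1 + 1)).surjective_rangeRestrict) ?_ ?_
  · intro x
    refine Iff.trans ?_ (hex (n + 1) x)
    simp [← Subtype.val_inj]
  · intro w hw
    choose h hh using fun k : Fin m =>
      (hhom n ((LinearMap.proj k).comp (s.comp w))).1 (by
        ext x
        have : w (d n x) = 0 := hw _ ((hex n).apply_apply_eq_zero x)
        simp [this])
    refine ⟨q.comp (LinearMap.pi h), LinearMap.ext fun x => ?_⟩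
    have h1 : LinearMap.pi h (d (n + 1) x) = s (w x) := by
      ext k
      exact LinearMap.congr_fun (hh k) x
    have h2 := LinearMap.congr_fun hs (w x)
    simp only [LinearMap.comp_apply, h1] at h2 ⊢
    exact h2

/-- A Gorenstein injective module of injective dimension at most one is injective. -/
lemma IsGI.injective_of_coresolution {K : Type u} [Field K] [Algebra K R] {N I₀ I₁ : Type u}
    [AddCommGroup N] [Module R N] [AddCommGroup I₀] [Module R I₀] [AddCommGroup I₁] [Module R I₁]
    (hN : IsGI R K N) (hI₀ : Module.Injective R I₀) (hI₁ : InAdd R (OpDual R K R) I₁)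
    (j : N →ₗ[R] I₀) (p : I₀ →ₗ[R] I₁) (hj : Injective j) (hp : Surjective p)
    (hjp : Function.Exact j p) : Module.Injective R N := by
  obtain ⟨I, _, _, d, -, hinj, hex, hhom, ⟨e⟩⟩ := hN
  generalize (-1 : ℤ) = n at e
  let ι : N →ₗ[R] I (n + 1) := (LinearMap.range (d n)).subtype.comp e.toLinearMap
  have hι : Injective ι := (Submodule.subtype_injective _).comp e.injective
  have hdι : ∀ x, d (n + 1) (ι x) = 0 := fun x => (hex n _).2 (e x).2
  obtain ⟨u, hu⟩ := (hinj (n + 1)).out j hj ι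
  obtain ⟨w, hw⟩ := exists_factor_of_ker_le p hp ((d (n + 1)).comp u) fun x hx => by
    obtain ⟨y, rfl⟩ := (hjp x).1 hx
    simp [hu, hdι]
  have hw' : ∀ x, w (p x) = d (n + 1) (u x) := fun x => LinearMap.congr_fun hw x
  obtain ⟨m, a, b, hba⟩ := hI₁
  choose h hh using fun k : Fin m =>
    (hhom (n + 1) ((w.comp b).comp (LinearMap.single R (fun _ => OpDual R K R) k))).1 (by
      ext x
      obtain ⟨y, hy⟩ := hp (b (Pi.single k x))
      have := (hex (n + 1)).apply_apply_eq_zero (u y)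
      rw [← hw', hy] at this
      exact this)
  let H : I₁ →ₗ[R] I (n + 1) := (∑ k, (h k).comp (LinearMap.proj k)).comp a
  have hH : ∀ y, d (n + 1) (H y) = w y := fun y => by
    have h1 : ∀ k x, d (n + 1) (h k x) = w (b (Pi.single k x)) :=
      fun k x => LinearMap.congr_fun (hh k) x
    have h2 := LinearMap.congr_fun hba y
    simp only [LinearMap.comp_apply, LinearMap.id_apply] at h2
    simp only [H, LinearMap.comp_apply, LinearMap.sum_apply, map_sum, LinearMap.proj_apply, h1]
    rw [← map_sum, ← map_sum, Finset.univ_sum_single, h2]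
  obtain ⟨r, hr⟩ := exists_factor_of_range_le ι hι (u - H.comp p) fun x => by
    obtain ⟨z, hz⟩ := (hex n ((u - H.comp p) x)).1 (by simp [hH, hw'])
    exact ⟨e.symm ⟨_, z, rfl⟩, by simp [ι, hz]⟩
  refine injective_of_retract hI₀ j r (LinearMap.ext fun x => hι ?_)
  have := LinearMap.congr_fun hr (j x)
  simp only [LinearMap.comp_apply, LinearMap.sub_apply, hjp.apply_apply_eq_zero, map_zero,
    sub_zero, hu] at this
  exact this

lemma exists_int_chain {α : Type*} (r : α → α → Prop) (hs : ∀ a, ∃ b, r a b)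
    (hp : ∀ b, ∃ a, r a b) (a : α) : ∃ f : ℤ → α, f 0 = a ∧ ∀ n, r (f n) (f (n + 1)) := by
  choose s hs using hs
  choose t ht using hp
  let f : ℤ → α := fun n => match n with
    | Int.ofNat k => s^[k] a
    | Int.negSucc k => t^[k + 1] a
  refine ⟨f, rfl, fun n => ?_⟩
  match n with
  | Int.ofNat k =>
    change r (s^[k] a) (s^[k + 1] a)
    rw [iterate_succ_apply']
    exact hs _
  | Int.negSucc 0 => exact ht a
  | Int.negSucc (k + 1) =>
    change r (t^[k + 1 + 1] a) (t^[k + 1] a)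
    rw [iterate_succ_apply' t (k + 1)]
    exact ht _

variable (R) in
/-- Every finitely generated module is the quotient of, and embeds into, a finitely generated
module which is both projective and injective. -/
def EnoughProjInj : Prop :=
  ∀ (M : Type u) [AddCommGroup M] [Module R M], Module.Finite R M →
    (∃ (P : Type u) (_ : AddCommGroup P) (_ : Module R P), Module.Finite R P ∧
      Module.Projective R P ∧ Module.Injective R P ∧ ∃ p : P →ₗ[R] M, Surjective p) ∧
    (∃ (P : Type u) (_ : AddCommGroup P) (_ : Module R P), Module.Finite R P ∧
      Module.Projective R P ∧ Module.Injective R P ∧ ∃ i : M →ₗ[R] P, Injective i)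

/-- Complete resolutions by modules which are both projective and injective. -/
lemma EnoughProjInj.exists_complete_resolution [IsNoetherianRing R] (h : EnoughProjInj R)
    (M : Type u) [AddCommGroup M] [Module R M] [Module.Finite R M] :
    ∃ (P : ℤ → Type u) (_ : ∀ n, AddCommGroup (P n)) (_ : ∀ n, Module R (P n))
      (d : ∀ n : ℤ, P n →ₗ[R] P (n + 1)),
      (∀ n, Module.Finite R (P n)) ∧ (∀ n, Module.Projective R (P n)) ∧
      (∀ n, Module.Injective R (P n)) ∧ (∀ n, Function.Exact (d n) (d (n + 1))) ∧
      Nonempty (M ≃ₗ[R] LinearMap.range (d (-1))) := by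
  let r : {X : ModuleCat.{u} R // Module.Finite R X} →
      {X : ModuleCat.{u} R // Module.Finite R X} → Prop := fun X Y =>
    ∃ (P : Type u) (_ : AddCommGroup P) (_ : Module R P), Module.Finite R P ∧
      Module.Projective R P ∧ Module.Injective R P ∧ ∃ (i : X.1 →ₗ[R] P) (p : P →ₗ[R] Y.1),
        Injective i ∧ Surjective p ∧ Function.Exact i p
  obtain ⟨f, hf0, hf⟩ := exists_int_chain r
    (fun X => by
      obtain ⟨P, _, _, hfin, hproj, hinj, i, hi⟩ := (h X.1 X.2).2
      refine ⟨⟨ModuleCat.of R (P ⧸ LinearMap.range i), inferInstanceAs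
        (Module.Finite R (P ⧸ LinearMap.range i))⟩, P, _, _, hfin, hproj, hinj, i,
        (LinearMap.range i).mkQ, hi, Submodule.mkQ_surjective _, ?_⟩
      exact LinearMap.exact_iff.2 (Submodule.ker_mkQ _))
    (fun X => by
      obtain ⟨P, _, _, hfin, hproj, hinj, p, hp⟩ := (h X.1 X.2).1
      refine ⟨⟨ModuleCat.of R (LinearMap.ker p), inferInstanceAs
        (Module.Finite R (LinearMap.ker p))⟩, P, _, _, hfin, hproj, hinj,
        (LinearMap.ker p).subtype, p, Submodule.subtype_injective _, hp, ?_⟩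
      exact LinearMap.exact_iff.2 (Submodule.range_subtype _).symm)
    ⟨ModuleCat.of R M, inferInstanceAs (Module.Finite R M)⟩
  choose P _ _ hfin hproj hinj i p hi hp hip using hf
  refine ⟨P, inferInstance, inferInstance, fun n => (i (n + 1)).comp (p n), hfin, hproj, hinj,
    fun n x => ?_, ?_⟩
  · simp only [LinearMap.comp_apply, Set.mem_range]
    rw [map_eq_zero_iff _ (hi _), hip (n + 1) x]
    constructor
    · rintro ⟨y, rfl⟩
      obtain ⟨z, rfl⟩ := hp n y
      exact ⟨z, rfl⟩
    · rintro ⟨z, rfl⟩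
      exact ⟨_, rfl⟩
  · have hr : LinearMap.range ((i (-1 + 1)).comp (p (-1))) = LinearMap.range (i (-1 + 1)) :=
      LinearMap.range_comp_of_range_eq_top _ (LinearMap.range_eq_top.2 (hp (-1)))
    have e : (f (-1 + 1)).1 ≃ₗ[R] LinearMap.range ((i (-1 + 1)).comp (p (-1))) :=
      (LinearEquiv.ofInjective _ (hi (-1 + 1))).trans (LinearEquiv.ofEq _ _ hr.symm)
    have hf0' : f (-1 + 1) = ⟨ModuleCat.of R M, inferInstanceAs (Module.Finite R M)⟩ := hf0
    have e' : M ≃ₗ[R] (f (-1 + 1)).1 := by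
      rw [hf0']
    exact ⟨e'.trans e⟩

lemma EnoughProjInj.isGP [IsNoetherianRing R] (h : EnoughProjInj R) (hR : Module.Injective R R)
    (M : Type u) [AddCommGroup M] [Module R M] [Module.Finite R M] : IsGP R M := by
  obtain ⟨P, _, _, d, hfin, hproj, -, hex, he⟩ := h.exists_complete_resolution M
  exact ⟨P, _, _, d, hfin, hproj, hex,
    fun n => exact_comp_right_of_injective hR _ _ (hex n), he⟩

lemma EnoughProjInj.isGI [IsNoetherianRing R] (h : EnoughProjInj R) (K : Type u) [Field K]
    [Algebra K R] (hD : Module.Projective R (OpDual R K R))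
    (M : Type u) [AddCommGroup M] [Module R M] [Module.Finite R M] : IsGI R K M := by
  obtain ⟨P, _, _, d, hfin, -, hinj, hex, he⟩ := h.exists_complete_resolution M
  exact ⟨P, _, _, d, hfin, hinj, hex,
    fun n => exact_comp_left_of_projective hD _ _ (hex n), he⟩

variable (R) (K : Type u) [Field K] [Algebra K R] [FiniteDimensional K R]

lemma projective_opDual_of_injective (h2 : SelfInjDimLE1 Rᵐᵒᵖ) (hR : Module.Injective R R) :
    Module.Projective R (OpDual R K R) := by
  obtain ⟨Q₁, Q₀, _, _, _, _, j, q, hfin, hQ₁, hQ₀, hj, hq, hjq⟩ := exists_resolution_opDual R K h2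
  obtain ⟨n, a, ha⟩ := Module.Finite.exists_fin' R Q₁
  obtain ⟨b, hb⟩ := LinearMap.exists_rightInverse_of_surjective a (LinearMap.range_eq_top.2 ha)
  have hinj : Module.Injective R Q₁ := injective_of_retract inferInstance b a hb
  obtain ⟨r, hr⟩ := exists_retraction hinj j hj
  have hr' : ∀ x, r (j x) = x := fun x => LinearMap.congr_fun hr x
  obtain ⟨s, hs⟩ := exists_factor_of_ker_le q hq (LinearMap.id - j.comp r) fun x hx => by
    obtain ⟨y, rfl⟩ := (hjq x).1 hx
    simp [hr']
  refine Module.Projective.of_split s q (LinearMap.ext fun x => ?_)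
  obtain ⟨y, rfl⟩ := hq x
  have := LinearMap.congr_fun hs y
  simp only [LinearMap.comp_apply] at this
  simp [this, hjq.apply_apply_eq_zero]

lemma enoughProjInj_of_injective (R : Type u) [Ring R] (K : Type u) [Field K] [Algebra K R]
    [FiniteDimensional K R] (h2 : SelfInjDimLE1 Rᵐᵒᵖ) (hR : Module.Injective R R) :
    EnoughProjInj R := by
  have hD := projective_opDual_of_injective R K h2 hR
  have hDinj := opDual_self_injective R K
  intro M _ _ hM
  constructor
  · obtain ⟨n, p, hp⟩ := Module.Finite.exists_fin' R M
    exact ⟨Fin n → R, _, _, inferInstance, inferInstance, inferInstance, p, hp⟩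
  · obtain ⟨n, i, hi⟩ := exists_embedding_opDual R K M
    exact ⟨Fin n → OpDual R K R, _, _, inferInstance,
      Module.Projective.of_equiv (DirectSum.linearEquivFunOnFintype R (Fin n)
        (fun _ => OpDual R K R)), inferInstance, i, hi⟩

/-- If the dual of the regular module is projective, then the algebra is self-injective. -/
lemma injective_of_projective_opDual (h1 : SelfInjDimLE1 R)
    (hD : Module.Projective R (OpDual R K R)) : Module.Injective R R := by
  obtain ⟨I₀, I₁, _, _, _, _, hf₀, hf₁, hI₀, hI₁, i, p, hi, hp, hip⟩ := h1
  obtain ⟨n, a, b, hab⟩ := inAdd_opDual_of_injective R K hI₁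
  have hpi : Module.Projective R (Fin n → OpDual R K R) :=
    Module.Projective.of_equiv (DirectSum.linearEquivFunOnFintype R (Fin n)
        (fun _ => OpDual R K R))
  have hproj : Module.Projective R I₁ := Module.Projective.of_split a b hab
  obtain ⟨s, hs⟩ := LinearMap.exists_rightInverse_of_surjective p (LinearMap.range_eq_top.2 hp)
  have hs' : ∀ x, p (s x) = x := fun x => LinearMap.congr_fun hs x
  obtain ⟨r, hr⟩ := exists_factor_of_range_le i hi (LinearMap.id - s.comp p) fun x =>
    (hip _).1 (by simp [hs'])
  refine injective_of_retract hI₀ i r (LinearMap.ext fun x => hi ?_)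
  have := LinearMap.congr_fun hr (i x)
  simp only [LinearMap.comp_apply, LinearMap.sub_apply, hip.apply_apply_eq_zero, map_zero,
    sub_zero] at this
  exact this

/-- If the dual of the regular module has no extensions by finitely generated projective modules,
then the algebra is self-injective. -/
lemma injective_of_ext1Vanishes (h1 : SelfInjDimLE1 R) (h2 : SelfInjDimLE1 Rᵐᵒᵖ)
    (h : ∀ (Q : Type u) [AddCommGroup Q] [Module R Q], Module.Finite R Q → Module.Projective R Q →
      Ext1Vanishes R (OpDual R K R) Q) : Module.Injective R R := by
  obtain ⟨Q₁, Q₀, _, _, _, _, j, q, hfin, hQ₁, hQ₀, hj, hq, hjq⟩ := exists_resolution_opDual R K h2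
  obtain ⟨s, hs⟩ := h Q₁ hfin hQ₁ Q₀ j q hj hq hjq
  exact injective_of_projective_opDual R K h1 (Module.Projective.of_split s q hs)

end Gorenstein

section Idempotents

/-- A primitive idempotent. -/
def IsPrimitiveIdem {S : Type*} [Ring S] (e : S) : Prop :=
  e ≠ 0 ∧ ∀ g : S, IsIdempotentElem g → e * g = g → g * e = g → g = 0 ∨ g = e

/-- Equivalence of idempotents. -/
def IdemEquiv {S : Type*} [Ring S] (e f : S) : Prop :=
  ∃ a b : S, a * b = e ∧ b * a = f

lemma IdemEquiv.symm {S : Type*} [Ring S] {e f : S} (h : IdemEquiv e f) : IdemEquiv f e :=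
  let ⟨a, b, hab, hba⟩ := h
  ⟨b, a, hba, hab⟩

lemma IdemEquiv.trans {S : Type*} [Ring S] {e f g : S} (he : IsIdempotentElem e)
    (hg : IsIdempotentElem g) (h : IdemEquiv e f) (h' : IdemEquiv f g) : IdemEquiv e g := by
  obtain ⟨a, b, rfl, rfl⟩ := h
  obtain ⟨c, d, hcd, rfl⟩ := h'
  refine ⟨a * c, d * b, ?_, ?_⟩
  · calc a * c * (d * b) = a * (c * d) * b := by noncomm_ring
      _ = (a * b) * (a * b) := by rw [hcd]; noncomm_ring
      _ = a * b := he
  · calc d * b * (a * c) = d * (b * a) * c := by noncomm_ring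
      _ = (d * c) * (d * c) := by rw [← hcd]; noncomm_ring
      _ = d * c := hg

/-- Every idempotent of a finite dimensional algebra is a sum of orthogonal primitive
idempotents. -/
lemma exists_orthogonal_primitive_sum (K : Type*) {S : Type*} [Field K] [Ring S] [Algebra K S]
    [FiniteDimensional K S] (N : ℕ) (e : S) (he : IsIdempotentElem e)
    (hN : Module.finrank K (LinearMap.range (LinearMap.mulLeft K e)) ≤ N) :
    ∃ (ι : Type) (_ : Fintype ι) (f : ι → S), OrthogonalIdempotents f ∧
      (∀ i, IsPrimitiveIdem (f i)) ∧ ∑ i, f i = e := by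
  induction N generalizing e with
  | zero =>
    have h0 : LinearMap.range (LinearMap.mulLeft K e) = ⊥ :=
      Submodule.finrank_eq_zero.1 (Nat.le_zero.1 hN)
    have : LinearMap.mulLeft K e 1 ∈ LinearMap.range (LinearMap.mulLeft K e) := ⟨1, rfl⟩
    rw [h0, Submodule.mem_bot, LinearMap.mulLeft_apply, mul_one] at this
    exact ⟨Empty, inferInstance, Empty.elim, ⟨fun i => i.elim, fun i => i.elim⟩,
      fun i => i.elim, by simp [this]⟩
  | succ N ih =>
    have key : ∀ g : S, IsIdempotentElem g → e * g = g → g * e = g → g ≠ e →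
        Module.finrank K (LinearMap.range (LinearMap.mulLeft K g)) ≤ N := by
      intro g hg heg hge hne
      refine Nat.le_of_lt_succ (lt_of_lt_of_le (Submodule.finrank_lt_finrank_of_lt
        (lt_of_le_of_ne ?_ ?_)) hN)
      · rintro _ ⟨x, rfl⟩
        exact ⟨g * x, by simp [← mul_assoc, heg]⟩
      · intro h
        have : LinearMap.mulLeft K e 1 ∈ LinearMap.range (LinearMap.mulLeft K e) := ⟨1, rfl⟩
        rw [← h] at this
        obtain ⟨x, hx⟩ := this
        simp only [LinearMap.mulLeft_apply, mul_one] at hx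
        refine hne ?_
        rw [← hge, ← hx, ← mul_assoc, hg.eq]
    by_cases hp : IsPrimitiveIdem e
    · exact ⟨Unit, inferInstance, fun _ => e, ⟨fun _ => he, fun i j h => (h rfl).elim⟩,
        fun _ => hp, by simp⟩
    by_cases h0 : e = 0
    · exact ⟨Empty, inferInstance, Empty.elim, ⟨fun i => i.elim, fun i => i.elim⟩,
        fun i => i.elim, by simp [h0]⟩
    have : ∃ g : S, IsIdempotentElem g ∧ e * g = g ∧ g * e = g ∧ g ≠ 0 ∧ g ≠ e := by
      by_contra! hcon
      exact hp ⟨h0, fun g hg h1 h2 => or_iff_not_imp_left.2 (hcon g hg h1 h2)⟩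
    obtain ⟨g, hg, heg, hge, hg0, hne⟩ := this
    have hgg : g * g = g := hg
    have hee : e * e = e := he
    obtain ⟨ι, _, a, ha, hap, has⟩ := ih g hg (key g hg heg hge hne)
    obtain ⟨κ, _, b, hb, hbp, hbs⟩ := ih (e - g)
      (by simp [IsIdempotentElem, mul_sub, sub_mul, heg, hge, hgg, hee])
      (key _ (by simp [IsIdempotentElem, mul_sub, sub_mul, heg, hge, hgg, hee])
        (by simp [mul_sub, heg, hee]) (by simp [sub_mul, hge, hee]) (by simpa using hg0))
    have ha1 : ∀ i, a i * g = a i := fun i => by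
      rw [← has, ha.mul_sum_of_mem (Finset.mem_univ i)]
    have ha2 : ∀ i, g * a i = a i := fun i => by
      classical
      rw [← has, Finset.sum_mul]
      simp [ha.mul_eq]
    have hb1 : ∀ i, b i * (e - g) = b i := fun i => by
      rw [← hbs, hb.mul_sum_of_mem (Finset.mem_univ i)]
    have hb2 : ∀ i, (e - g) * b i = b i := fun i => by
      classical
      rw [← hbs, Finset.sum_mul]
      simp [hb.mul_eq]
    refine ⟨ι ⊕ κ, inferInstance, Sum.elim a b, ⟨?_, ?_⟩, ?_, ?_⟩
    · rintro (i | i)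
      exacts [ha.idem i, hb.idem i]
    · rintro (i | i) (j | j) hij
      · exact ha.ortho fun h => hij (congrArg _ h)
      · change a i * b j = 0
        rw [← ha1, ← hb2, mul_assoc, ← mul_assoc g, mul_sub, hge, hgg]; simp
      · change b i * a j = 0
        rw [← hb1, ← ha2, mul_assoc, ← mul_assoc (e - g), sub_mul, heg, hgg]; simp
      · exact hb.ortho fun h => hij (congrArg _ h)
    · rintro (i | i)
      exacts [hap i, hbp i]
    · simp [has, hbs]

/-- A finite dimensional algebra has a complete set of orthogonal primitive idempotents, together
with an enumeration of their equivalence classes. -/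
lemma exists_completeOrthogonal_primitive (K : Type*) {S : Type*} [Field K] [Ring S] [Algebra K S]
    [FiniteDimensional K S] :
    ∃ (n k : ℕ) (e : Fin n → S) (c : Fin n → Fin k), CompleteOrthogonalIdempotents e ∧
      (∀ i, IsPrimitiveIdem (e i)) ∧ Surjective c ∧
      ∀ i j, c i = c j ↔ IdemEquiv (e i) (e j) := by
  obtain ⟨ι, _, f, hf, hfp, hfs⟩ := exists_orthogonal_primitive_sum K _ (1 : S) .one le_rfl
  let e : Fin (Fintype.card ι) → S := f ∘ (Fintype.equivFin ι).symm
  have he : CompleteOrthogonalIdempotents e :=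
    (CompleteOrthogonalIdempotents.equiv _).2 ⟨hf, hfs⟩
  classical
  let s : Setoid (Fin (Fintype.card ι)) :=
    { r := fun i j => IdemEquiv (e i) (e j)
      iseqv := ⟨fun i => ⟨e i, e i, he.idem i, he.idem i⟩, IdemEquiv.symm,
        fun {i j k} => IdemEquiv.trans (he.idem i) (he.idem k)⟩ }
  refine ⟨_, Fintype.card (Quotient s), e, fun i => Fintype.equivFin _ (Quotient.mk s i), he,
    fun i => hfp _, (Fintype.equivFin _).surjective.comp Quotient.mk_surjective, fun i j => ?_⟩
  rw [(Fintype.equivFin _).apply_eq_iff_eq]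
  exact Quotient.eq

variable {R : Type u} [Ring R] {M : Type u} [AddCommGroup M] [Module R M]

lemma isInternal_range {n : ℕ} {E : Fin n → Module.End R M}
    (hE : CompleteOrthogonalIdempotents E) :
    DirectSum.IsInternal fun i => LinearMap.range (E i) := by
  rw [DirectSum.isInternal_submodule_iff_iSupIndep_and_iSup_eq_top]
  constructor
  · rw [iSupIndep_iff_finsetSum_eq_zero_imp_eq_zero]
    intro s v hv hs i hi
    have h1 : ∀ j ∈ s, E i (v j) = if i = j then v i else 0 := fun j hj => by
      obtain ⟨x, hx⟩ := hv j hj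
      rw [← hx, ← Module.End.mul_apply, hE.mul_eq]
      split_ifs with h
      · subst h; exact hx
      · rfl
    have h2 := congrArg (E i) hs
    rw [map_sum, map_zero, Finset.sum_congr rfl h1] at h2
    simpa [hi] using h2
  · refine eq_top_iff.2 fun x _ => ?_
    have h1 : x = ∑ i, E i x := by
      rw [← LinearMap.sum_apply, hE.complete]; rfl
    rw [h1]
    exact Submodule.sum_mem _ fun i _ => Submodule.mem_iSup_of_mem i ⟨x, rfl⟩

lemma isIndec_range {e : Module.End R M} (he : IsIdempotentElem e) (hp : IsPrimitiveIdem e) :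
    IsIndec R (LinearMap.range e) := by
  have hee : ∀ x, e (e x) = e x := fun x => LinearMap.congr_fun he x
  have hfix : ∀ x : LinearMap.range e, e x = x := by
    rintro ⟨_, x, rfl⟩
    exact hee x
  refine ⟨?_, fun N₁ N₂ h => ?_⟩
  · rw [Submodule.nontrivial_iff_ne_bot]
    exact fun h => hp.1 (LinearMap.range_eq_bot.1 h)
  let g : Module.End R M := (LinearMap.range e).subtype ∘ₗ N₁.subtype ∘ₗ
    N₁.projectionOnto N₂ h ∘ₗ e.rangeRestrict
  have hg₁ : ∀ x : N₁, g (x : LinearMap.range e) = (x : LinearMap.range e) := fun x => by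
    have : e.rangeRestrict (x : LinearMap.range e) = x := Subtype.ext (hfix _)
    change ((N₁.projectionOnto N₂ h (e.rangeRestrict (x : LinearMap.range e)) :
      LinearMap.range e) : M) = _
    rw [this, Submodule.projectionOnto_apply_left]
  have hg₂ : ∀ x : N₂, g (x : LinearMap.range e) = 0 := fun x => by
    have : e.rangeRestrict (x : LinearMap.range e) = x := Subtype.ext (hfix _)
    change ((N₁.projectionOnto N₂ h (e.rangeRestrict (x : LinearMap.range e)) :
      LinearMap.range e) : M) = _
    rw [this, Submodule.projectionOnto_apply_right]
    rfl
  have hge : g * e = g := LinearMap.ext fun x => by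
    have : e.rangeRestrict (e x) = e.rangeRestrict x := Subtype.ext (hee x)
    change ((N₁.projectionOnto N₂ h (e.rangeRestrict (e x)) : LinearMap.range e) : M) = _
    rw [this]; rfl
  rcases hp.2 g (LinearMap.ext fun x => hg₁ _) (LinearMap.ext fun x => hfix _) hge with h0 | h0
  · left
    refine (Submodule.eq_bot_iff _).2 fun x hx => Subtype.ext ?_
    rw [← hg₁ ⟨x, hx⟩, h0]; rfl
  · right
    refine (Submodule.eq_bot_iff _).2 fun x hx => Subtype.ext ?_
    exact (hfix x).symm.trans ((LinearMap.congr_fun h0 _).symm.trans (hg₂ ⟨x, hx⟩))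

lemma nonempty_range_equiv_iff {e f : Module.End R M} (he : IsIdempotentElem e)
    (hf : IsIdempotentElem f) :
    Nonempty (LinearMap.range e ≃ₗ[R] LinearMap.range f) ↔ IdemEquiv e f := by
  have hfixe : ∀ x : LinearMap.range e, e x = x := by
    rintro ⟨_, x, rfl⟩
    exact LinearMap.congr_fun he x
  have hfixf : ∀ x : LinearMap.range f, f x = x := by
    rintro ⟨_, x, rfl⟩
    exact LinearMap.congr_fun hf x
  have hre : ∀ x : LinearMap.range e, e.rangeRestrict x = x := fun x => Subtype.ext (hfixe x)
  have hrf : ∀ x : LinearMap.range f, f.rangeRestrict x = x := fun x => Subtype.ext (hfixf x)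
  constructor
  · rintro ⟨φ⟩
    refine ⟨(LinearMap.range e).subtype ∘ₗ φ.symm.toLinearMap ∘ₗ f.rangeRestrict,
      (LinearMap.range f).subtype ∘ₗ φ.toLinearMap ∘ₗ e.rangeRestrict,
      LinearMap.ext fun x => ?_, LinearMap.ext fun x => ?_⟩
    · simp [hrf]
    · simp [hre]
  · rintro ⟨a, b, hab, hba⟩
    have hab' : ∀ x, a (b x) = e x := fun x => LinearMap.congr_fun hab x
    have hba' : ∀ x, b (a x) = f x := fun x => LinearMap.congr_fun hba x
    refine ⟨LinearEquiv.ofLinearMap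
      ((b ∘ₗ (LinearMap.range e).subtype).codRestrict (LinearMap.range f) fun x =>
        ⟨b x, by simp [← hba', hab', hfixe]⟩)
      ((a ∘ₗ (LinearMap.range f).subtype).codRestrict (LinearMap.range e) fun x =>
        ⟨a x, by simp [← hab', hba', hfixf]⟩)
      (LinearMap.ext fun x => Subtype.ext ?_) (LinearMap.ext fun x => Subtype.ext ?_)⟩
    · exact (hba' _).trans (hfixf x)
    · exact (hab' _).trans (hfixe x)

/-- A complete set of orthogonal primitive idempotents of the endomorphism ring computes the number
of indecomposable summands. -/
lemma numIndec_of_idempotents {S : Type*} [Ring S] (θ : S ≃+* Module.End R M) {n k : ℕ}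
    {e : Fin n → S} {c : Fin n → Fin k} (he : CompleteOrthogonalIdempotents e)
    (hp : ∀ i, IsPrimitiveIdem (e i)) (hc : Surjective c)
    (hce : ∀ i j, c i = c j ↔ IdemEquiv (e i) (e j)) : NumIndec R M k := by
  have hE := he.map θ.toRingHom
  refine ⟨n, _, isInternal_range hE, fun i => isIndec_range (hE.idem i) ⟨?_, fun g hg h1 h2 => ?_⟩,
    c, hc, fun i j => ?_⟩
  · exact fun h => (hp i).1 (θ.injective (h.trans (map_zero θ).symm))
  · obtain ⟨g, rfl⟩ := θ.surjective g
    refine ((hp i).2 g (θ.injective ((map_mul θ _ _).trans hg))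
      (θ.injective ((map_mul θ _ _).trans h1)) (θ.injective ((map_mul θ _ _).trans h2))).imp
      (fun h => by rw [h, map_zero]) (fun h => by rw [h]; rfl)
  · rw [nonempty_range_equiv_iff (hE.idem i) (hE.idem j), hce]
    constructor
    · rintro ⟨a, b, hab, hba⟩
      exact ⟨θ a, θ b, by rw [← map_mul, hab]; rfl, by rw [← map_mul, hba]; rfl⟩
    · rintro ⟨a, b, hab, hba⟩
      obtain ⟨a, rfl⟩ := θ.surjective a
      obtain ⟨b, rfl⟩ := θ.surjective b
      exact ⟨a, b, θ.injective ((map_mul θ _ _).trans hab),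
        θ.injective ((map_mul θ _ _).trans hba)⟩

variable (R) (K : Type u) [Field K] [Algebra K R] [FiniteDimensional K R]

/-- The action of `Rᵐᵒᵖ` on the dual of the regular module by endomorphisms. -/
def opDualEnd : Rᵐᵒᵖ →+* Module.End R (OpDual R K R) where
  toFun r :=
    { toFun := fun φ => (OpDual.toL R K R φ).comp (LinearMap.mulLeft K (unop r))
      map_add' := fun _ _ => rfl
      map_smul' := fun s φ => OpDual.toL_injective R K R <| LinearMap.ext fun x =>
        congrArg (OpDual.toL R K R φ) (mul_assoc (unop r) x s) }
  map_one' := LinearMap.ext fun φ => OpDual.toL_injective R K R <| LinearMap.ext fun x =>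
    congrArg (OpDual.toL R K R φ) (one_mul x)
  map_mul' r s := LinearMap.ext fun φ => OpDual.toL_injective R K R <| LinearMap.ext fun x =>
    congrArg (OpDual.toL R K R φ) (mul_assoc (unop s) (unop r) x)
  map_zero' := LinearMap.ext fun φ => OpDual.toL_injective R K R <| LinearMap.ext fun x =>
    (congrArg (OpDual.toL R K R φ) (zero_mul x)).trans (map_zero _)
  map_add' r s := LinearMap.ext fun φ => OpDual.toL_injective R K R <| LinearMap.ext fun x =>
    (congrArg (OpDual.toL R K R φ) (add_mul (unop r) (unop s) x)).trans (map_add _ _ _)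

lemma opDualEnd_bijective : Bijective (opDualEnd R K) := by
  constructor
  · refine (injective_iff_map_eq_zero _).2 fun r hr => ?_
    have h1 : ∀ φ : Module.Dual K R, φ (unop r) = 0 := fun φ => by
      have h2 := LinearMap.congr_fun (congrArg (OpDual.toL R K R)
        (LinearMap.congr_fun hr (show OpDual R K R from φ))) (1 : R)
      rw [← mul_one (unop r)]
      exact h2
    exact unop_injective ((Module.forall_dual_apply_eq_zero_iff K _).1 h1)
  · intro g
    let ξ : Module.Dual K (Module.Dual K R) :=
      { toFun := fun φ => OpDual.toL R K R (g φ) 1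
        map_add' := fun φ ψ => by
          have := g.map_add φ ψ
          exact LinearMap.congr_fun (congrArg (OpDual.toL R K R) this) (1 : R)
        map_smul' := fun k φ => by
          have h1 : g (k • (show OpDual R K R from φ)) = k • g φ := by
            rw [← algebraMap_smul R k, ← algebraMap_smul R k, g.map_smul]
          exact LinearMap.congr_fun (congrArg (OpDual.toL R K R) h1) (1 : R) }
    obtain ⟨r, hr⟩ := (Module.evalEquiv K R).surjective ξ
    have hr' : ∀ φ : OpDual R K R, OpDual.toL R K R φ r = OpDual.toL R K R (g φ) 1 :=
      fun φ => LinearMap.congr_fun hr φ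
    refine ⟨op r, LinearMap.ext fun φ => OpDual.toL_injective R K R <| LinearMap.ext fun x => ?_⟩
    have h1 := hr' (x • φ)
    rw [g.map_smul, OpDual.smul_toL, OpDual.smul_toL, op_smul_eq_mul, op_smul_eq_mul,
      one_mul] at h1
    exact h1

/-- The regular module and its dual have the same number of indecomposable summands. -/
lemma exists_numIndec : ∃ k, NumIndec R R k ∧ NumIndec R (OpDual R K R) k := by
  obtain ⟨n, k, e, c, he, hp, hc, hce⟩ := exists_completeOrthogonal_primitive K (S := Rᵐᵒᵖ)
  exact ⟨k, numIndec_of_idempotents (RingEquiv.moduleEndSelf R) he hp hc hce,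
    numIndec_of_idempotents (RingEquiv.ofBijective _ (opDualEnd_bijective R K)) he hp hc hce⟩

end Idempotents

section Rigidity

variable (R : Type u) [Ring R] (K : Type u) [Field K] [Algebra K R] [FiniteDimensional K R]

lemma isTauRigid_opDual (h2 : SelfInjDimLE1 Rᵐᵒᵖ) : IsTauRigid R K (OpDual R K R) := by
  intro pr f
  obtain ⟨Q₁, Q₀, _, _, _, _, j, q, -, hQ₁, hQ₀, hj, hq, hjq⟩ := exists_resolution_opDual R K h2
  have hd := pr.d_injective hQ₁ hQ₀ j q hj hq hjq
  have hfK : ∀ (k : K) φ, f (k • φ) = k • f φ := fun k φ => by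
    rw [← algebraMap_smul R k, ← algebraMap_smul R k, f.map_smul]
  let ξ : pr.Tr → Module.Dual K (Module.Dual K R) := fun t =>
    { toFun := fun φ => OpDual.toL R K pr.Tr (f φ) t
      map_add' := fun φ ψ =>
        LinearMap.congr_fun (congrArg (OpDual.toL R K pr.Tr) (f.map_add φ ψ)) t
      map_smul' := fun k φ =>
        LinearMap.congr_fun (congrArg (OpDual.toL R K pr.Tr) (hfK k φ)) t }
  choose g hg using fun t => (Module.evalEquiv K R).surjective (ξ t)
  have hg' : ∀ t (φ : OpDual R K R), OpDual.toL R K R φ (g t) = OpDual.toL R K pr.Tr (f φ) t :=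
    fun t φ => LinearMap.congr_fun (hg t) φ
  have hext : ∀ x y : R, (∀ φ : OpDual R K R, OpDual.toL R K R φ x = OpDual.toL R K R φ y) →
      x = y := fun x y h => (Module.evalEquiv K R).injective (LinearMap.ext h)
  let G : pr.Tr →+ R :=
    { toFun := g
      map_zero' := hext _ _ fun φ => by rw [hg', map_zero, map_zero]
      map_add' := fun s t => hext _ _ fun φ => by
        rw [map_add, hg', hg', hg', map_add] }
  have hG : G = 0 := pr.Tr_hom_eq_zero hd G fun s t => hext _ _ fun φ => by
    have h1 := hg' t (s • φ)
    rw [f.map_smul] at h1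
    exact (hg' (op s • t) φ).trans h1.symm
  refine LinearMap.ext fun φ => OpDual.toL_injective R K pr.Tr <| LinearMap.ext fun t => ?_
  rw [← hg', show g t = 0 from DFunLike.congr_fun hG t, map_zero]
  rfl

lemma isTauInvRigid_self (h1 : SelfInjDimLE1 R) : IsTauInvRigid R K R := by
  intro pr f hf
  obtain ⟨Q₁, Q₀, _, _, _, _, j, q, hQ₁, hQ₀, hj, hq, hjq⟩ := exists_resolution_lDual R K h1
  have hd := pr.d_injective hQ₁ hQ₀ j q hj hq hjq
  have h0 := pr.Tr_hom_eq_zero hd ((opAddEquiv : R ≃+ Rᵐᵒᵖ).toAddMonoidHom.comp f) fun s x =>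
    congrArg op (hf (unop s) x)
  exact AddMonoidHom.ext fun x => op_injective (DFunLike.congr_fun h0 x)

lemma isQuotientByIdem_zero : IsQuotientByIdem R 0 R (RingHom.id R) :=
  ⟨surjective_id, rfl, fun _ _ ψ _ => ⟨ψ, rfl⟩⟩

lemma isSuppTauTilting_opDual (h2 : SelfInjDimLE1 Rᵐᵒᵖ) :
    IsSuppTauTilting R K (OpDual R K R) := by
  obtain ⟨k, hR, hD⟩ := exists_numIndec R K
  exact ⟨0, .zero, R, _, _, RingHom.id R, fun _ => rfl, isQuotientByIdem_zero R, _,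
    fun _ _ => rfl, isTauRigid_opDual R K h2, k, k, hD, hR, rfl⟩

lemma isSuppTauInvTilting_self (h1 : SelfInjDimLE1 R) : IsSuppTauInvTilting R K R := by
  obtain ⟨k, hR, -⟩ := exists_numIndec R K
  exact ⟨0, .zero, R, _, _, RingHom.id R, fun _ => rfl, isQuotientByIdem_zero R, _,
    fun _ _ => rfl, inferInstance, isTauInvRigid_self R K h1, k, k, hR, hR, rfl⟩

lemma injective_of_isGP_opDual (h1 : SelfInjDimLE1 R) (h2 : SelfInjDimLE1 Rᵐᵒᵖ)
    (h : IsGP R (OpDual R K R)) : Module.Injective R R :=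
  injective_of_ext1Vanishes R K h1 h2 fun _ _ _ _ _ => h.ext1Vanishes

lemma injective_of_isGI_self (h1 : SelfInjDimLE1 R) (h : IsGI R K R) : Module.Injective R R := by
  obtain ⟨I₀, I₁, _, _, _, _, hf₀, hf₁, hI₀, hI₁, i, p, hi, hp, hip⟩ := h1
  exact h.injective_of_coresolution hI₀ (inAdd_opDual_of_injective R K hI₁) i p hi hp hip

end Rigidity

section InjectiveQuotients

/-- The finitely generated quotients of finitely generated injective modules. -/
def IsInjQuot (R : Type u) [Ring R] (X : Type u) [AddCommGroup X] [Module R X] : Prop :=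
  ∃ (J : Type u) (_ : AddCommGroup J) (_ : Module R J),
    Module.Finite R J ∧ Module.Injective R J ∧ ∃ p : J →ₗ[R] X, Surjective p

/-- The class of finitely generated modules without nonzero maps from finitely generated injective
modules. -/
def IsInjQuotFree (R : Type u) [Ring R] (Y : Type u) [AddCommGroup Y] [Module R Y] : Prop :=
  Module.Finite R Y ∧ ∀ (J : Type u) [AddCommGroup J] [Module R J], Module.Finite R J →
    Module.Injective R J → ∀ f : J →ₗ[R] Y, f = 0

variable {R : Type u} [Ring R]

lemma IsInjQuot.of_injective {J : Type u} [AddCommGroup J] [Module R J] (hf : Module.Finite R J)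
    (hJ : Module.Injective R J) : IsInjQuot R J :=
  ⟨J, _, _, hf, hJ, LinearMap.id, surjective_id⟩

lemma IsInjQuot.of_surjective {X Y : Type u} [AddCommGroup X] [Module R X] [AddCommGroup Y]
    [Module R Y] (hX : IsInjQuot R X) (f : X →ₗ[R] Y) (hf : Surjective f) : IsInjQuot R Y := by
  obtain ⟨J, _, _, hJf, hJ, p, hp⟩ := hX
  exact ⟨J, _, _, hJf, hJ, f.comp p, hf.comp hp⟩

lemma IsInjQuot.finite {X : Type u} [AddCommGroup X] [Module R X] (hX : IsInjQuot R X) :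
    Module.Finite R X := by
  obtain ⟨J, _, _, hJf, hJ, p, hp⟩ := hX
  exact .of_surjective p hp

/-- If `R` has self-injective dimension at most one, then every finitely generated module `X`
has a left approximation by quotients of injective modules which is a monomorphism with
finitely generated injective cokernel. -/
lemma exists_left_approx (h1 : SelfInjDimLE1 R) (X : Type u) [AddCommGroup X] [Module R X]
    [Module.Finite R X] :
    ∃ (M C : Type u) (_ : AddCommGroup M) (_ : Module R M) (_ : AddCommGroup C) (_ : Module R C)
      (f : X →ₗ[R] M) (g : M →ₗ[R] C), IsInjQuot R M ∧ Module.Finite R C ∧ Module.Injective R C ∧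
      Injective f ∧ Surjective g ∧ Function.Exact f g ∧
      ∀ (M' : Type u) [AddCommGroup M'] [Module R M'], IsInjQuot R M' →
        ∀ a : X →ₗ[R] M', ∃ b : M →ₗ[R] M', b.comp f = a := by
  obtain ⟨I₀, I₁, _, _, _, _, hf₀, hf₁, hI₀, hI₁, i, p, hi, hp, hip⟩ := h1
  obtain ⟨n, π, hπ⟩ := Module.Finite.exists_fin' R X
  let iPow : (Fin n → R) →ₗ[R] (Fin n → I₀) := LinearMap.pi fun k => i.comp (LinearMap.proj k)
  let p' : (Fin n → I₀) →ₗ[R] (Fin n → I₁) := LinearMap.pi fun k => p.comp (LinearMap.proj k)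
  have hi' : Injective iPow := fun x y h => funext fun k => hi (congrFun h k)
  have hp' : Surjective p' := fun y => ⟨fun k => (hp (y k)).choose,
    funext fun k => (hp (y k)).choose_spec⟩
  have hip' : Function.Exact iPow p' := fun x => by
    constructor
    · intro h
      choose y hy using fun k => (hip (x k)).1 (congrFun h k)
      exact ⟨y, funext hy⟩
    · rintro ⟨y, rfl⟩
      exact funext fun k => hip.apply_apply_eq_zero (y k)
  let W := (LinearMap.ker π).map iPow
  obtain ⟨f, hf⟩ := exists_factor_of_ker_le π hπ (W.mkQ.comp iPow) fun x hx =>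
    (Submodule.Quotient.mk_eq_zero W).2 ⟨x, hx, rfl⟩
  have hf' : ∀ x, f (π x) = W.mkQ (iPow x) := fun x => LinearMap.congr_fun hf x
  obtain ⟨g, hg⟩ := exists_factor_of_ker_le W.mkQ W.mkQ_surjective p' fun x hx => by
    obtain ⟨y, -, rfl⟩ := (Submodule.Quotient.mk_eq_zero W).1 hx
    exact hip'.apply_apply_eq_zero y
  have hg' : ∀ x, g (W.mkQ x) = p' x := fun x => LinearMap.congr_fun hg x
  refine ⟨(Fin n → I₀) ⧸ W, Fin n → I₁, _, _, _, _, f, g,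
    ⟨Fin n → I₀, _, _, inferInstance, inferInstance, W.mkQ, W.mkQ_surjective⟩, inferInstance,
    inferInstance, ?_, ?_, ?_, ?_⟩
  · refine (injective_iff_map_eq_zero f).2 fun x hx => ?_
    obtain ⟨y, rfl⟩ := hπ x
    rw [hf'] at hx
    obtain ⟨z, hz, hzy⟩ := (Submodule.Quotient.mk_eq_zero W).1 hx
    rw [← hi' hzy]
    exact hz
  · intro y
    obtain ⟨x, rfl⟩ := hp' y
    exact ⟨W.mkQ x, hg' x⟩
  · intro x
    obtain ⟨x, rfl⟩ := W.mkQ_surjective x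
    rw [hg', hip' x]
    constructor
    · rintro ⟨y, rfl⟩
      exact ⟨π y, hf' y⟩
    · rintro ⟨y, hy⟩
      obtain ⟨y, rfl⟩ := hπ y
      rw [hf'] at hy
      obtain ⟨z, -, hz⟩ := (Submodule.Quotient.eq W).1 hy
      exact ⟨y - z, by rw [map_sub, hz]; abel⟩
  · rintro M' _ _ ⟨J, _, _, -, hJ, q, hq⟩ a
    obtain ⟨b, hb⟩ := Module.projective_lifting_property q (a.comp π) hq
    obtain ⟨c, hc⟩ := hJ.out iPow hi' b
    have hqc : ∀ x, q (c (iPow x)) = a (π x) := fun x => by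
      rw [hc]; exact LinearMap.congr_fun hb x
    obtain ⟨d, hd⟩ := exists_factor_of_ker_le W.mkQ W.mkQ_surjective (q.comp c) fun x hx => by
      obtain ⟨y, hy, rfl⟩ := (Submodule.Quotient.mk_eq_zero W).1 hx
      rw [LinearMap.comp_apply, hqc, show π y = 0 from hy, map_zero]
    refine ⟨d, LinearMap.ext fun x => ?_⟩
    obtain ⟨x, rfl⟩ := hπ x
    rw [LinearMap.comp_apply, hf', ← hqc]
    exact LinearMap.congr_fun hd (iPow x)

/-- An Ext-projective module in the class of quotients of injective modules is injective. -/
lemma IsInjQuot.injective_of_extProjective [IsNoetherianRing R] (h1 : SelfInjDimLE1 R)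
    {X : Type u} [AddCommGroup X] [Module R X] (hX : IsInjQuot R X)
    (h : ∀ (Y : Type u) [AddCommGroup Y] [Module R Y], IsInjQuot R Y → Ext1Vanishes R X Y) :
    Module.Injective R X := by
  obtain ⟨J, _, _, hJf, hJ, f, hf⟩ := hX
  obtain ⟨M, C, _, _, _, _, μ, ν, hM, hCf, hC, hμ, hν, hμν, -⟩ :=
    exists_left_approx h1 (LinearMap.ker f)
  let ι := (LinearMap.ker f).subtype
  have hex : Function.Exact ι f := LinearMap.exact_iff.2 (Submodule.range_subtype _).symm
  obtain ⟨a, ha⟩ := (h M hM).exists_extend ι f (Submodule.subtype_injective _) hf hex μ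
  obtain ⟨ρ, hρ⟩ := hJ.out μ hμ ι
  have ha' : ∀ y, a (ι y) = μ y := fun y => LinearMap.congr_fun ha y
  have hfι : ∀ y, f (ι y) = 0 := fun y => hex.apply_apply_eq_zero y
  obtain ⟨s, hs⟩ := exists_factor_of_ker_le f hf
    ((LinearMap.id - ρ.comp a).prod (ν.comp a)) fun x hx => by
      obtain ⟨y, rfl⟩ := (hex x).1 hx
      simp [ha', hρ, hμν.apply_apply_eq_zero]
  obtain ⟨t, ht⟩ := exists_factor_of_ker_le ν hν (f.comp ρ) fun x hx => by
    obtain ⟨y, rfl⟩ := (hμν x).1 hx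
    simp [hρ, hfι]
  have ht' : ∀ x, t (ν x) = f (ρ x) := fun x => LinearMap.congr_fun ht x
  refine injective_of_retract (injective_prod hJ hC) s (f.coprod t) (LinearMap.ext fun x => ?_)
  obtain ⟨x, rfl⟩ := hf x
  rw [LinearMap.comp_apply, show s (f x) = _ from LinearMap.congr_fun hs x]
  simp [ht']

/-- Every finitely generated module has a largest submodule which is a quotient of an injective
module, provided that these are closed under extensions. -/
lemma exists_torsion_submodule [IsNoetherianRing R]
    (hT : ∀ (J X : Type u) [AddCommGroup J] [Module R J] [AddCommGroup X] [Module R X],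
      Module.Finite R J → Module.Injective R J → IsInjQuot R X → Ext1Vanishes R J X)
    (X : Type u) [AddCommGroup X] [Module R X] [Module.Finite R X] :
    ∃ t : Submodule R X, IsInjQuot R t ∧ IsInjQuotFree R (X ⧸ t) := by
  let S : Set (Submodule R X) := {t | IsInjQuot R t}
  have hS : S.Nonempty := ⟨⊥, IsInjQuot.of_injective inferInstance
    ⟨fun _ _ _ _ _ _ _ _ _ => ⟨0, fun _ => Subsingleton.elim _ _⟩⟩⟩
  obtain ⟨t, ht, hmax⟩ := WellFounded.has_min (wellFounded_gt (α := Submodule R X)) S hS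
  refine ⟨t, ht, inferInstance, fun J _ _ hJf hJ f => ?_⟩
  obtain ⟨g, hg⟩ := (hT J t hJf hJ ht).exists_lift t.subtype t.mkQ t.subtype_injective
    t.mkQ_surjective (LinearMap.exact_iff.2 (by simp)) f
  obtain ⟨J', _, _, hJf', hJ', q, hq⟩ := ht
  let r : (J' × J) →ₗ[R] X := (t.subtype.comp q).coprod g
  have hr : IsInjQuot R (LinearMap.range r) :=
    (IsInjQuot.of_injective inferInstance (injective_prod hJ' hJ)).of_surjective
      r.rangeRestrict r.surjective_rangeRestrict
  have hle : t ≤ LinearMap.range r := fun x hx => by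
    obtain ⟨y, hy⟩ := hq ⟨x, hx⟩
    exact ⟨(y, 0), by simp [r, hy]⟩
  have heq : LinearMap.range r = t :=
    (eq_or_lt_of_le hle).elim Eq.symm fun h => (hmax _ hr h).elim
  refine LinearMap.ext fun x => ?_
  rw [← hg]
  refine (Submodule.Quotient.mk_eq_zero t).2 ?_
  rw [← heq]
  exact ⟨(0, x), by simp [r]⟩

end InjectiveQuotients

section BasicGenerator

variable {R : Type u} [Ring R]

lemma InAdd.of_fintype {ι : Type*} [Finite ι] {G X : Type u} [AddCommGroup G] [Module R G]
    [AddCommGroup X] [Module R X] (i : X →ₗ[R] (ι → G)) (p : (ι → G) →ₗ[R] X)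
    (h : p.comp i = LinearMap.id) : InAdd R G X := by
  obtain ⟨n, ⟨e⟩⟩ := Finite.exists_equiv_fin ι
  refine ⟨n, (LinearEquiv.funCongrLeft R G e.symm).toLinearMap.comp i,
    p.comp (LinearEquiv.funCongrLeft R G e).toLinearMap, LinearMap.ext fun x => ?_⟩
  have h1 : (LinearEquiv.funCongrLeft R G e) ((LinearEquiv.funCongrLeft R G e.symm) (i x)) = i x :=
    funext fun k => congrArg (i x) (e.symm_apply_apply k)
  change p ((LinearEquiv.funCongrLeft R G e) ((LinearEquiv.funCongrLeft R G e.symm) (i x))) = x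
  rw [h1]
  exact LinearMap.congr_fun h x

lemma InAdd.trans {G D X : Type u} [AddCommGroup G] [Module R G] [AddCommGroup D] [Module R D]
    [AddCommGroup X] [Module R X] (hD : InAdd R G D) (hX : InAdd R D X) : InAdd R G X := by
  obtain ⟨n, i, p, hpi⟩ := hD
  obtain ⟨m, j, q, hqj⟩ := hX
  have hpi' : ∀ x, p (i x) = x := fun x => LinearMap.congr_fun hpi x
  refine InAdd.of_fintype (ι := Fin m × Fin n)
    (LinearMap.pi fun k => (LinearMap.proj k.2).comp (i.comp ((LinearMap.proj k.1).comp j)))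
    (q.comp (LinearMap.pi fun a => p.comp (LinearMap.pi fun b => LinearMap.proj (a, b))))
    (LinearMap.ext fun x => ?_)
  refine Eq.trans (congrArg q (funext fun a => ?_)) (LinearMap.congr_fun hqj x)
  exact hpi' (j x a)

lemma IsIndec.of_equiv {X Y : Type u} [AddCommGroup X] [Module R X] [AddCommGroup Y] [Module R Y]
    (e : X ≃ₗ[R] Y) (hX : IsIndec R X) : IsIndec R Y := by
  have := hX.1
  refine ⟨e.symm.toEquiv.nontrivial, fun N₁ N₂ h => ?_⟩
  have h' : IsCompl (N₁.comap e.toLinearMap) (N₂.comap e.toLinearMap) :=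
    h.map (Submodule.orderIsoMapComap e).symm
  refine (hX.2 _ _ h').imp (fun h => ?_) fun h => ?_
  · exact (Submodule.orderIsoMapComap e).symm.injective
      (h.trans (map_bot (Submodule.orderIsoMapComap e).symm).symm)
  · exact (Submodule.orderIsoMapComap e).symm.injective
      (h.trans (map_bot (Submodule.orderIsoMapComap e).symm).symm)

lemma isBasic_pi {k : ℕ} {N : Fin k → Type u} [∀ i, AddCommGroup (N i)] [∀ i, Module R (N i)]
    (h : ∀ i, IsIndec R (N i)) (hne : ∀ i j, i ≠ j → ¬ Nonempty (N i ≃ₗ[R] N j)) :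
    IsBasic R (∀ i, N i) := by
  let E : Fin k → Module.End R (∀ i, N i) := fun i =>
    (LinearMap.single R N i).comp (LinearMap.proj i)
  have hE : CompleteOrthogonalIdempotents E :=
    { idem := fun i => LinearMap.ext fun x => by simp [E]
      ortho := fun i j hij => LinearMap.ext fun x => by
        simp [E, Pi.single_eq_of_ne hij]
      complete := LinearMap.ext fun x => by
        simp only [E, LinearMap.sum_apply]
        exact Finset.univ_sum_single x }
  have e : ∀ i, Nonempty (N i ≃ₗ[R] LinearMap.range (E i)) := fun i => by
    have hr : LinearMap.range (E i) = LinearMap.range (LinearMap.single R N i) :=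
      LinearMap.range_comp_of_range_eq_top _
        (LinearMap.range_eq_top.2 (LinearMap.proj_surjective i))
    exact ⟨(LinearEquiv.ofInjective _ (Pi.single_injective i)).trans (LinearEquiv.ofEq _ _ hr.symm)⟩
  refine ⟨k, _, isInternal_range hE, fun i => (h i).of_equiv (e i).some, fun i j hij ⟨f⟩ => ?_⟩
  exact hne i j hij ⟨((e i).some.trans f).trans (e j).some.symm⟩

/-- A module which is a finite direct sum of indecomposables has the same additive closure as a
basic module. -/
lemma NumIndec.exists_isBasic {D : Type u} [AddCommGroup D] [Module R D] {k : ℕ}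
    (h : NumIndec R D k) :
    ∃ (G : Type u) (_ : AddCommGroup G) (_ : Module R G),
      IsBasic R G ∧ InAdd R G D ∧ InAdd R D G := by
  obtain ⟨n, N, hN, hind, c, hc, hce⟩ := h
  choose r hr using hc
  let e : (∀ i, N i) ≃ₗ[R] D :=
    (DirectSum.linearEquivFunOnFintype R (Fin n) fun i => N i).symm.trans
      (LinearEquiv.ofBijective (DirectSum.coeLinearMap N) hN)
  have φ : ∀ i, N i ≃ₗ[R] N (r (c i)) := fun i => ((hce _ _).1 (hr _).symm).some
  refine ⟨∀ j, N (r j), inferInstance, inferInstance,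
    isBasic_pi (fun j => hind _) fun i j hij hne => hij ?_, ?_, ?_⟩
  · rw [← hr i, ← hr j, (hce _ _).2 hne]
  · refine InAdd.of_fintype (ι := Fin n)
      (LinearMap.pi fun i => (LinearMap.single R (fun j => N (r j)) (c i)).comp
        ((φ i).toLinearMap.comp ((LinearMap.proj i).comp e.symm.toLinearMap)))
      (e.toLinearMap.comp (LinearMap.pi fun i => (φ i).symm.toLinearMap.comp
        ((LinearMap.proj (φ := fun j => N (r j)) (c i)).comp
          (LinearMap.proj (φ := fun _ : Fin n => ∀ j, N (r j)) i))))
      (LinearMap.ext fun x => ?_)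
    refine Eq.trans (congrArg e (funext fun i => ?_)) (e.apply_symm_apply x)
    simp
  · refine InAdd.of_fintype (ι := Fin k)
      (LinearMap.pi fun j => e.toLinearMap.comp
        ((LinearMap.single R (fun i => N i) (r j)).comp (LinearMap.proj j)))
      (LinearMap.pi fun j => (LinearMap.proj (r j)).comp
        (e.symm.toLinearMap.comp (LinearMap.proj j))) (LinearMap.ext fun x => funext fun j => ?_)
    simp

lemma ext1Vanishes_of_isInjQuot (R : Type u) [Ring R] (K : Type u) [Field K] [Algebra K R]
    [FiniteDimensional K R] (h2 : SelfInjDimLE1 Rᵐᵒᵖ) {J X : Type u} [AddCommGroup J]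
    [Module R J] [AddCommGroup X] [Module R X] [Module.Finite R J] (hJ : Module.Injective R J)
    (hX : IsInjQuot R X) : Ext1Vanishes R J X := by
  refine Ext1Vanishes.of_inAdd (inAdd_opDual_of_injective R K hJ) ?_
  obtain ⟨Q₁, Q₀, _, _, _, _, j, q, -, hQ₁, hQ₀, hj, hq, hjq⟩ := exists_resolution_opDual R K h2
  obtain ⟨I, _, _, -, hI, p, hp⟩ := hX
  refine ext1Vanishes_of_extends hQ₀ j q hq hjq fun w _ => ?_
  obtain ⟨v, hv⟩ := Module.projective_lifting_property p w hp
  obtain ⟨u, hu⟩ := hI.out j hj v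
  refine ⟨p.comp u, LinearMap.ext fun x => ?_⟩
  rw [← hv]
  exact congrArg p (hu x)

lemma isTorsionPair_isInjQuot (R : Type u) [Ring R] (K : Type u) [Field K] [Algebra K R]
    [FiniteDimensional K R] (h2 : SelfInjDimLE1 Rᵐᵒᵖ) :
    IsTorsionPair R (fun X => IsInjQuot R X) (fun X => IsInjQuotFree R X) := by
  have : IsNoetherianRing R := isNoetherian_of_tower K inferInstance
  refine ⟨fun X Y ⟨e⟩ hX => hX.of_surjective e.toLinearMap e.surjective, fun X Y ⟨e⟩ hX => ?_,
    fun X hX => hX.finite, fun X hX => hX.1, fun X Y hX hY f => ?_, fun X hX => ?_⟩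
  · have := hX.1
    refine ⟨Module.Finite.equiv e, fun J _ _ hJf hJ f => LinearMap.ext fun x => ?_⟩
    have h0 := hX.2 J hJf hJ (e.symm.toLinearMap.comp f)
    exact e.symm.injective ((LinearMap.congr_fun h0 x).trans (map_zero e.symm).symm)
  · obtain ⟨J, _, _, hJf, hJ, p, hp⟩ := hX
    refine LinearMap.ext fun x => ?_
    obtain ⟨x, rfl⟩ := hp x
    exact LinearMap.congr_fun (hY.2 J hJf hJ (f.comp p)) x
  · exact exists_torsion_submodule
      (fun J Y _ _ _ _ _ hJ hY => ext1Vanishes_of_isInjQuot R K h2 hJ hY) X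

lemma functoriallyFinite_isInjQuot (R : Type u) [Ring R] (K : Type u) [Field K] [Algebra K R]
    [FiniteDimensional K R] (h1 : SelfInjDimLE1 R) (h2 : SelfInjDimLE1 Rᵐᵒᵖ) :
    FunctoriallyFinite R (fun X => IsInjQuot R X) := by
  obtain ⟨-, -, -, -, horth, hdec⟩ := isTorsionPair_isInjQuot R K h2
  refine ⟨fun X hX => ?_, fun X hX => ?_⟩
  · obtain ⟨M, C, _, _, _, _, f, g, hM, -, -, -, -, -, h⟩ := exists_left_approx h1 X
    exact ⟨ModuleCat.of R M, f, hM, fun M' a hM' => h M' hM' a⟩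
  · obtain ⟨t, ht, hF⟩ := hdec X hX
    refine ⟨ModuleCat.of R t, t.subtype, ht, fun M' g hM' => ?_⟩
    have h0 := horth M' (ModuleCat.of R (X ⧸ t)) hM' hF (t.mkQ.comp g)
    exact ⟨g.codRestrict t fun x => (Submodule.Quotient.mk_eq_zero t).1
      (LinearMap.congr_fun h0 x), LinearMap.subtype_comp_codRestrict _ _ _⟩

lemma exists_isBasicExtProjGen (R : Type u) [Ring R] (K : Type u) [Field K] [Algebra K R]
    [FiniteDimensional K R] (h1 : SelfInjDimLE1 R) (h2 : SelfInjDimLE1 Rᵐᵒᵖ) :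
    ∃ G : ModuleCat.{u} R, IsBasicExtProjGen R (fun X => IsInjQuot R X) G ∧
      InAdd R G (OpDual R K R) := by
  have : IsNoetherianRing R := isNoetherian_of_tower K inferInstance
  obtain ⟨k, -, hk⟩ := exists_numIndec R K
  obtain ⟨G, _, _, hbasic, hGD, hDG⟩ := hk.exists_isBasic
  have hDinj := opDual_self_injective R K
  obtain ⟨hGf, hGinj⟩ : Module.Finite R G ∧ Module.Injective R G := by
    obtain ⟨n, i, p, hpi⟩ := hDG
    exact ⟨.of_surjective p fun x => ⟨i x, LinearMap.congr_fun hpi x⟩,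
      injective_of_retract inferInstance i p hpi⟩
  refine ⟨ModuleCat.of R G, ⟨.of_injective hGf hGinj, hbasic,
    fun X hX => ext1Vanishes_of_isInjQuot R K h2 hGinj hX, fun X => ⟨fun hX => ⟨hX.finite, ?_⟩, ?_⟩,
    fun X hX h => ?_⟩, hGD⟩
  · obtain ⟨J, _, _, hJf, hJ, q, hq⟩ := hX
    obtain ⟨n, i, p, hpi⟩ := hGD.trans (inAdd_opDual_of_injective R K hJ)
    exact ⟨n, q.comp p, hq.comp fun x => ⟨i x, LinearMap.congr_fun hpi x⟩⟩
  · rintro ⟨hf, n, p, hp⟩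
    exact ⟨Fin n → G, _, _, inferInstance, inferInstance, p, hp⟩
  · have := hX.finite
    exact hGD.trans (inAdd_opDual_of_injective R K
      (hX.injective_of_extProjective h1 fun Y _ _ hY => h (ModuleCat.of R Y) hY))

end BasicGenerator

/-- For a 1-Iwanaga-Gorenstein algebra `R` (the self-injective
dimension of `R` on either side is at most 1) the following are equivalent:
(1) `R` is self-injective; (2) all functorially finite torsion pairs are
Gorenstein; (3) all support τ-tilting modules are Gorenstein projective;
(4) all support τ⁻¹-tilting modules are Gorenstein injective; (5) all τ-rigid
modules are Gorenstein projective; (6) all τ⁻¹-rigid modules are Gorenstein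
injective. -/
theorem one_iwanaga_gorenstein_selfinjective_tfae (K R : Type u) [Field K] [Ring R]
    [Algebra K R] [FiniteDimensional K R]
    (h1 : SelfInjDimLE1 R) (h2 : SelfInjDimLE1 Rᵐᵒᵖ) :
    List.TFAE
      [ Module.Injective R R,
        ∀ T F : ModuleCat.{u} R → Prop, IsTorsionPair R T F →
          FunctoriallyFinite R T → IsGorensteinTP R T F,
        ∀ (M : Type u) [AddCommGroup M] [Module R M], Module.Finite R M →
          IsSuppTauTilting R K M → IsGP R M,
        ∀ (M : Type u) [AddCommGroup M] [Module R M] [Module K M]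
          [IsScalarTower K R M], Module.Finite R M →
          IsSuppTauInvTilting R K M → IsGI R K M,
        ∀ (M : Type u) [AddCommGroup M] [Module R M], Module.Finite R M →
          IsTauRigid R K M → IsGP R M,
        ∀ (M : Type u) [AddCommGroup M] [Module R M] [Module K M]
          [IsScalarTower K R M], Module.Finite R M →
          IsTauInvRigid R K M → IsGI R K M ] := by
  have : IsNoetherianRing R := isNoetherian_of_tower K inferInstance
  have hGP (hR : Module.Injective R R) (M : Type u) [AddCommGroup M] [Module R M]
      [Module.Finite R M] : IsGP R M := (enoughProjInj_of_injective R K h2 hR).isGP hR M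
  have hGI (hR : Module.Injective R R) (M : Type u) [AddCommGroup M] [Module R M]
      [Module.Finite R M] : IsGI R K M :=
    (enoughProjInj_of_injective R K h2 hR).isGI K (projective_opDual_of_injective R K h2 hR) M
  tfae_have 1 → 2 := fun hR T F hTF hff =>
    ⟨hTF, hff, fun G hG => have := hTF.2.2.1 G hG.1; hGP hR G⟩
  tfae_have 1 → 3 := fun hR M _ _ _ _ => hGP hR M
  tfae_have 1 → 4 := fun hR M _ _ _ _ _ _ => hGI hR M
  tfae_have 1 → 5 := fun hR M _ _ _ _ => hGP hR M
  tfae_have 1 → 6 := fun hR M _ _ _ _ _ _ => hGI hR M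
  tfae_have 2 → 1 := fun h => by
    obtain ⟨G, hG, hGD⟩ := exists_isBasicExtProjGen R K h1 h2
    have hGP := (h _ _ (isTorsionPair_isInjQuot R K h2)
      (functoriallyFinite_isInjQuot R K h1 h2)).2.2 G hG
    exact injective_of_ext1Vanishes R K h1 h2 fun Q _ _ _ _ =>
      Ext1Vanishes.of_inAdd hGD hGP.ext1Vanishes
  tfae_have 3 → 1 := fun h =>
    injective_of_isGP_opDual R K h1 h2 (h _ inferInstance (isSuppTauTilting_opDual R K h2))
  tfae_have 4 → 1 := fun h =>
    injective_of_isGI_self R K h1 (h R inferInstance (isSuppTauInvTilting_self R K h1))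
  tfae_have 5 → 1 := fun h =>
    injective_of_isGP_opDual R K h1 h2 (h _ inferInstance (isTauRigid_opDual R K h2))
  tfae_have 6 → 1 := fun h =>
    injective_of_isGI_self R K h1 (h R inferInstance (isTauInvRigid_self R K h1))
  tfae_finish

end GPTau
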